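/- arXiv:2301.05834 — 2 statements merged into one kernel-verified Lean document; each statement's English description precedes it below -/
import Mathlib

section
/- For every integer n ≥ 3, there exists a lattice tiling of ℤⁿ by the error ball B(n,2,1,1) if and only if n = 11. -/
/-- The error ball `B(n,2,1,1)`: vectors in `ℤⁿ` with entries in `{-1,0,1}`
and at most `2` nonzero coordinates. -/
def errBall (n : ℕ) : Set (Fin n → ℤ) :=
  {a | (∀ i, a i = -1 ∨ a i = 0 ∨ a i = 1) ∧
    (Finset.univ.filter (fun i => a i ≠ 0)).card ≤ 2}

/-- A lattice tiling of `ℤⁿ` by `V`: a subgroup `L` such that every `x ∈ ℤⁿ`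
is uniquely `v + l` with `v ∈ V`, `l ∈ L`. -/
def IsLatticeTiling (n : ℕ) (V : Set (Fin n → ℤ)) (L : AddSubgroup (Fin n → ℤ)) : Prop :=
  ∀ x : Fin n → ℤ, ∃! p : (Fin n → ℤ) × (Fin n → ℤ),
    p.1 ∈ V ∧ p.2 ∈ L ∧ x = p.1 + p.2

set_option linter.unusedSectionVars false

structure Cfg {G : Type*} [AddCommGroup G] [Fintype G] [DecidableEq G] (n : ℕ) (A : Finset G) : Prop where
  zero : (0 : G) ∈ A
  neg : ∀ a ∈ A, -a ∈ A
  card : A.card = 2 * n + 1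
  two : ∀ a ∈ A, a + a = 0 → a = 0
  ex : ∀ g : G, g ≠ 0 → ∃ p ∈ A, ∃ q ∈ A, p ≠ q ∧ p + q = g
  uniq : ∀ x ∈ A, ∀ y ∈ A, ∀ z ∈ A, ∀ w ∈ A, x ≠ y → z ≠ w → x + y = z + w → x + y ≠ 0 →
    (z = x ∧ w = y) ∨ (z = y ∧ w = x)

section core
variable {G : Type*} [AddCommGroup G] [Fintype G] [DecidableEq G] {n : ℕ} {A : Finset G}

def ind (A : Finset G) (x : G) : ℤ := if x ∈ A then 1 else 0

lemma ind_mul_self (x : G) : ind A x * ind A x = ind A x := by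
  unfold ind; split_ifs <;> simp

lemma ind_nonneg (x : G) : 0 ≤ ind A x := by
  unfold ind; split_ifs <;> simp

lemma Cfg.ind_neg (h : Cfg n A) (x : G) : ind A (-x) = ind A x := by
  unfold ind
  have : -x ∈ A ↔ x ∈ A := ⟨fun hx => by simpa using h.neg _ hx, h.neg x⟩
  simp [this]

lemma Cfg.ind_zero (h : Cfg n A) : ind A 0 = 1 := by simp [ind, h.zero]

lemma Cfg.sum_ind (h : Cfg n A) : ∑ x, ind A x = 2 * n + 1 := by
  simp [ind, h.card]

lemma Cfg.sum_ind_sub (h : Cfg n A) (c : G) : ∑ x, ind A (x - c) = 2 * n + 1 := by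
  rw [← h.sum_ind]
  exact Equiv.sum_comp (Equiv.subRight c) (ind A)

def rr (A : Finset G) (g : G) : ℤ := ∑ x, ind A x * ind A (g - x)

lemma Cfg.rr_ne (h : Cfg n A) (g : G) (hg : g ≠ 0) :
    rr A g = 2 + ∑ x, ind A x * (if x + x = g then 1 else 0) := by
  obtain ⟨p, hp, q, hq, hpq, hs⟩ := h.ex g hg
  have key : ∀ x, ind A x * ind A (g - x) = (if x = p then (1:ℤ) else 0) + (if x = q then 1 else 0)
      + ind A x * (if x + x = g then 1 else 0) := by
    intro x
    by_cases hx : x ∈ A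
    · by_cases hx2 : x + x = g
      · have e : g - x = x := by rw [← hx2]; abel
        have n1 : x ≠ p := by
          rintro rfl; apply hpq; have := hs.trans hx2.symm; exact (add_left_cancel this).symm
        have n2 : x ≠ q := by
          rintro rfl; apply hpq; have := hs.trans hx2.symm; exact (add_right_cancel this)
        simp [ind, hx, hx2, e, n1, n2]
      · by_cases hy : g - x ∈ A
        · have := h.uniq p hp q hq x hx (g - x) hy hpq
            (fun e => hx2 (by rw [e] ; nth_rewrite 2 [← e]; abel)) (by rw [hs]; abel) (by rwa [hs])
          rcases this with ⟨rfl, e⟩ | ⟨rfl, e⟩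
          · simp [ind, hx, hy, hx2, hpq]
          · simp [ind, hx, hy, hx2, hpq.symm]
        · have n1 : x ≠ p := by rintro rfl; apply hy; rw [← hs]; simpa using hq
          have n2 : x ≠ q := by rintro rfl; apply hy; rw [← hs]; simpa using hp
          simp [ind, hx, hx2, hy, n1, n2]
    · have n1 : x ≠ p := by rintro rfl; exact hx hp
      have n2 : x ≠ q := by rintro rfl; exact hx hq
      simp [ind, hx, n1, n2]
  unfold rr
  rw [Finset.sum_congr rfl (fun x _ => key x)]
  simp [Finset.sum_add_distrib]

lemma Cfg.rr_zero (h : Cfg n A) : rr A 0 = 2 * n + 1 := by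
  unfold rr
  rw [← h.sum_ind]
  refine Finset.sum_congr rfl fun x _ => ?_
  rw [zero_sub, h.ind_neg, ind_mul_self]

lemma Cfg.rr_eq (h : Cfg n A) (g : G) :
    rr A g = 2 + ∑ x, ind A x * (if x + x = g then 1 else 0) + (2 * n - 2) * (if g = 0 then 1 else 0) := by
  by_cases hg : g = 0
  · subst hg
    have : ∑ x, ind A x * (if x + x = 0 then 1 else 0) = 1 := by
      rw [Finset.sum_eq_single 0]
      · simp [h.ind_zero]
      · intro b _ hb
        by_cases hA : b ∈ A
        · have : b + b ≠ 0 := fun e => hb (h.two b hA e)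
          simp [this]
        · simp [ind, hA]
      · simp
    rw [h.rr_zero, this]; simp
    ring
  · rw [h.rr_ne g hg]; simp [hg]

lemma Cfg.sum_rr (h : Cfg n A) : ∑ g, rr A g = (2 * n + 1) ^ 2 := by
  unfold rr
  rw [Finset.sum_comm]
  simp_rw [← Finset.mul_sum, h.sum_ind_sub]
  rw [← Finset.sum_mul, h.sum_ind]; ring

lemma Cfg.cardG (h : Cfg n A) : (Fintype.card G : ℤ) = 2 * n ^ 2 + 1 := by
  have h1 := h.sum_rr
  simp_rw [h.rr_eq] at h1
  rw [Finset.sum_add_distrib, Finset.sum_add_distrib, Finset.sum_comm] at h1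
  simp_rw [← Finset.mul_sum] at h1
  simp [h.sum_ind] at h1
  linarith

lemma Cfg.cardG' (h : Cfg n A) : Fintype.card G = 2 * n ^ 2 + 1 := by
  exact_mod_cast h.cardG

lemma Cfg.dbl_inj (h : Cfg n A) : Function.Injective (fun x : G => x + x) := by
  intro x y hxy
  have h2 : (2 : ℕ) • (x - y) = 0 := by
    simp only at hxy
    rw [two_nsmul]
    have : x - y + (x - y) = (x + x) - (y + y) := by abel
    rw [this, hxy, sub_self]
  have hc : Nat.Coprime (Nat.card G) 2 := by
    rw [Nat.card_eq_fintype_card, h.cardG']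
    rw [Nat.coprime_two_right]
    exact ⟨n^2, by ring⟩
  have := addOrderOf_dvd_of_nsmul_eq_zero h2
  have h3 := addOrderOf_dvd_natCard (x - y)
  have h4 := Nat.dvd_gcd h3 this
  rw [hc.gcd_eq_one, Nat.dvd_one, AddMonoid.addOrderOf_eq_one_iff] at h4
  exact sub_eq_zero.mp h4

noncomputable def Cfg.dbl (h : Cfg n A) : G ≃ G :=
  Equiv.ofBijective (fun x : G => x + x) (Finite.injective_iff_bijective.mp h.dbl_inj)

lemma Cfg.sum_dbl (h : Cfg n A) (F : G → ℤ) : ∑ x, F (x + x) = ∑ x, F x :=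
  Equiv.sum_comp h.dbl F

lemma Cfg.rr_dbl (h : Cfg n A) (g : G) :
    rr A (g + g) = 2 + ind A g + (2 * n - 2) * (if g = 0 then 1 else 0) := by
  rw [h.rr_eq]
  have e1 : ∀ x, x + x = g + g ↔ x = g := fun x => h.dbl_inj.eq_iff (a := x) (b := g)
  have e2 : g + g = 0 ↔ g = 0 := by simpa using h.dbl_inj.eq_iff (a := g) (b := 0)
  simp [e1, e2]

def bb (A : Finset G) (g : G) : ℤ := ∑ x, ind A x * ind A (g - (x + x))

def mm (A : Finset G) (g : G) : ℤ := ∑ x, ind A x * (if x + x + x = g then 1 else 0)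

lemma Cfg.sum_bb (h : Cfg n A) : ∑ g, bb A g = (2 * n + 1) ^ 2 := by
  unfold bb
  rw [Finset.sum_comm]
  simp_rw [← Finset.mul_sum, h.sum_ind_sub]
  rw [← Finset.sum_mul, h.sum_ind]; ring

lemma Cfg.sum_mm (h : Cfg n A) : ∑ g, mm A g = 2 * n + 1 := by
  unfold mm
  rw [Finset.sum_comm]
  simp_rw [← Finset.mul_sum]
  simp [h.sum_ind]

lemma mm_nonneg (g : G) : 0 ≤ mm A g :=
  Finset.sum_nonneg fun x _ => mul_nonneg (ind_nonneg x) (by split_ifs <;> simp)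

lemma bb_nonneg (g : G) : 0 ≤ bb A g :=
  Finset.sum_nonneg fun x _ => mul_nonneg (ind_nonneg x) (ind_nonneg _)

/-- translates -/
lemma Cfg.sum_shift (h : Cfg n A) (u w : G) : ∑ g, ind A (g - u) * ind A (g - w) = rr A (w - u) := by
  unfold rr
  rw [← Equiv.sum_comp (Equiv.addRight u)]
  refine Finset.sum_congr rfl fun x _ => ?_
  rw [← h.ind_neg (w - u - x)]
  simp only [Equiv.coe_addRight]
  congr 2 <;> abel

lemma Cfg.sum_ind_bb (h : Cfg n A) : ∑ g, ind A g * bb A g = 8 * n + 1 := by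
  unfold bb
  simp_rw [Finset.mul_sum]
  rw [Finset.sum_comm]
  have : ∀ x, ∑ g, ind A g * (ind A x * ind A (g - (x + x))) = ind A x * rr A (x + x) := by
    intro x
    have := h.sum_shift 0 (x + x)
    simp only [sub_zero] at this
    rw [← this, Finset.mul_sum]
    exact Finset.sum_congr rfl fun g _ => by ring
  simp_rw [this, h.rr_dbl]
  have : ∀ x, ind A x * (2 + ind A x + (2 * n - 2) * (if x = 0 then 1 else 0)) =
      3 * ind A x + (2 * n - 2) * (ind A x * (if x = 0 then 1 else 0)) := by
    intro x
    have := ind_mul_self (A := A) x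
    linear_combination this
  simp_rw [this]
  rw [Finset.sum_add_distrib, ← Finset.mul_sum, ← Finset.mul_sum, h.sum_ind]
  simp [h.ind_zero]; ring

lemma Cfg.bb_zero' (h : Cfg n A) : bb A 0 = ∑ d, ind A d * ind A (d + d) := by
  unfold bb
  refine Finset.sum_congr rfl fun x _ => ?_
  rw [zero_sub, h.ind_neg]

lemma Cfg.sum_rr_ind (h : Cfg n A) : ∑ d, rr A d * ind A d = 6 * n + bb A 0 := by
  rw [← h.sum_dbl]
  simp_rw [h.rr_dbl]
  have : ∀ x, (2 + ind A x + (2 * n - 2) * (if x = 0 then 1 else 0)) * ind A (x + x) =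
      2 * ind A (x + x) + ind A x * ind A (x + x) + (2 * n - 2) * ((if x = 0 then 1 else 0) * ind A (x + x)) := by
    intro x; ring
  simp_rw [this]
  rw [Finset.sum_add_distrib, Finset.sum_add_distrib, ← Finset.mul_sum, ← Finset.mul_sum, h.sum_dbl (ind A),
    h.sum_ind, ← h.bb_zero']
  simp [h.ind_zero]; ring

lemma Cfg.sum_bb_sq (h : Cfg n A) : ∑ g, bb A g ^ 2 = 12 * n ^ 2 + 12 * n + bb A 0 := by
  have e1 : ∀ g, bb A g ^ 2 = ∑ x, ∑ y, (ind A x * ind A y) * (ind A (g - (x + x)) * ind A (g - (y + y))) := by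
    intro g
    rw [sq]; unfold bb
    rw [Finset.sum_mul_sum]
    refine Finset.sum_congr rfl fun x _ => Finset.sum_congr rfl fun y _ => by ring
  simp_rw [e1]
  rw [Finset.sum_comm]
  have e2 : ∀ x, ∑ g, ∑ y, (ind A x * ind A y) * (ind A (g - (x + x)) * ind A (g - (y + y))) =
      ∑ d, ind A x * ind A (d + x) * rr A (d + d) := by
    intro x
    rw [Finset.sum_comm]
    simp_rw [← Finset.mul_sum, h.sum_shift]
    rw [← Equiv.sum_comp (Equiv.addRight x)]
    refine Finset.sum_congr rfl fun d _ => ?_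
    simp only [Equiv.coe_addRight]
    congr 2; abel
  simp_rw [e2]
  rw [Finset.sum_comm]
  have e3 : ∀ d, ∑ x, ind A x * ind A (d + x) * rr A (d + d) = rr A d * rr A (d + d) := by
    intro d
    rw [← Finset.sum_mul]
    congr 1
    unfold rr
    rw [← Equiv.sum_comp (Equiv.neg G)]
    refine Finset.sum_congr rfl fun x _ => ?_
    simp [h.ind_neg, sub_eq_add_neg]
  simp_rw [e3, h.rr_dbl]
  have : ∀ d, rr A d * (2 + ind A d + (2 * n - 2) * (if d = 0 then 1 else 0)) =
      2 * rr A d + rr A d * ind A d + (2 * n - 2) * (rr A d * (if d = 0 then 1 else 0)) := by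
    intro x; ring
  simp_rw [this]
  rw [Finset.sum_add_distrib, Finset.sum_add_distrib, ← Finset.mul_sum, ← Finset.mul_sum, h.sum_rr,
    h.sum_rr_ind]
  simp [h.rr_zero]; ring

lemma Cfg.ind_mul_dbl (h : Cfg n A) (x : G) : ind A x * ind A (x + x) = ind A x * (if x + x + x = 0 then 1 else 0) := by
  by_cases hx : x ∈ A
  · by_cases h3 : x + x + x = 0
    · have : x + x = -x := eq_neg_of_add_eq_zero_left h3
      simp [this, h.ind_neg, ind_mul_self]
    · have hx0 : x ≠ 0 := by rintro rfl; simp at h3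
      have : x + x ∉ A := by
        intro h2
        have := h.uniq x hx 0 h.zero (x + x) h2 (-x) (h.neg x hx) hx0 
          (fun e => h3 (by rw [e]; abel)) (by abel) (by simpa using hx0)
        rcases this with ⟨e, _⟩ | ⟨e, _⟩
        · exact hx0 (by simpa using e)
        · exact hx0 (h.two x hx e)
      simp [ind, this, h3]
  · simp [ind, hx]

lemma Cfg.bb_zero (h : Cfg n A) : bb A 0 = mm A 0 := by
  rw [h.bb_zero']; unfold mm
  exact Finset.sum_congr rfl fun x _ => h.ind_mul_dbl x

lemma Cfg.triple (h : Cfg n A) (g : G) :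
    ∑ x, ∑ y, ind A x * ind A y * ind A (g - x - y) = 2 * (2 * n + 1) + bb A g + (2 * n - 2) * ind A g := by
  have e1 : ∀ x, ∑ y, ind A x * ind A y * ind A (g - x - y) = ind A x * rr A (g - x) := by
    intro x; unfold rr; rw [Finset.mul_sum]; exact Finset.sum_congr rfl fun y _ => by ring
  simp_rw [e1]
  rw [← Equiv.sum_comp (Equiv.subLeft g)]
  simp only [Equiv.subLeft_apply, sub_sub_cancel]
  rw [← h.sum_dbl]
  simp_rw [h.rr_dbl]
  have : ∀ w, ind A (g - (w + w)) * (2 + ind A w + (2 * n - 2) * (if w = 0 then 1 else 0)) =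
      2 * ind A (g - (w + w)) + ind A w * ind A (g - (w + w)) + (2 * n - 2) * (ind A (g - (w + w)) * (if w = 0 then 1 else 0)) := by
    intro x; ring
  simp_rw [this]
  rw [Finset.sum_add_distrib, Finset.sum_add_distrib, ← Finset.mul_sum, ← Finset.mul_sum,
    h.sum_dbl (fun w => ind A (g - w))]
  have : ∑ w, ind A (g - w) = 2 * n + 1 := by
    rw [← h.sum_ind]
    exact Equiv.sum_comp (Equiv.subLeft g) (ind A)
  rw [this]
  simp
  rfl

lemma triple_mod (g : G) :
    (∑ x, ∑ y, ind A x * ind A y * ind A (g - x - y)) ≡ mm A g [ZMOD 3] := by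
  classical
  let T := {p : G × G // p.1 ∈ A ∧ p.2 ∈ A ∧ g - p.1 - p.2 ∈ A}
  have c1 : (∑ x, ∑ y, ind A x * ind A y * ind A (g - x - y)) = (Fintype.card T : ℤ) := by
    rw [← Fintype.sum_prod_type' (f := fun x y => ind A x * ind A y * ind A (g - x - y)), Fintype.card_subtype, Finset.card_filter]
    push_cast
    refine Finset.sum_congr rfl fun p _ => ?_
    unfold ind
    split_ifs <;> simp_all
  let f : Function.End T := fun p => ⟨(p.1.2, g - p.1.1 - p.1.2), p.2.2.1, p.2.2.2, by
    have : g - p.1.2 - (g - p.1.1 - p.1.2) = p.1.1 := by abel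
    simpa [this] using p.2.1⟩
  have hf : f ^ 3 ^ 1 = 1 := by
    funext p
    show f (f (f p)) = p
    apply Subtype.ext
    apply Prod.ext
    · simp [f]
    · simp only [f]; abel
  have : Fact (Nat.Prime 3) := ⟨Nat.prime_three⟩
  have := Equiv.Perm.card_fixedPoints_modEq hf
  have c2 : mm A g = (Fintype.card (Function.fixedPoints f) : ℤ) := by
    have e : Fintype.card (Function.fixedPoints f) = (Finset.univ.filter (fun x : G => x ∈ A ∧ x + x + x = g)).card := by
      rw [← Fintype.card_subtype]
      refine Fintype.card_congr ⟨fun p => ⟨p.1.1.1, p.1.2.1, ?_⟩, fun x => ⟨⟨(x.1, x.1), x.2.1, x.2.1, ?_⟩, ?_⟩, ?_, ?_⟩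
      · have hp := p.2
        have h1 : p.1.1.2 = p.1.1.1 := congrArg (fun q : T => q.1.1) hp
        have h2 : g - p.1.1.1 - p.1.1.2 = p.1.1.2 := congrArg (fun q : T => q.1.2) hp
        rw [h1] at h2
        rw [sub_eq_iff_eq_add, sub_eq_iff_eq_add] at h2
        exact h2.symm
      · have : g - x.1 - x.1 = x.1 := by
          rw [sub_eq_iff_eq_add, sub_eq_iff_eq_add]; exact x.2.2.symm
        simpa [this] using x.2.1
      · apply Subtype.ext
        apply Prod.ext
        · rfl
        · show g - x.1 - x.1 = x.1
          rw [sub_eq_iff_eq_add, sub_eq_iff_eq_add]; exact x.2.2.symm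
      · intro p
        have hp := p.2
        have h1 : p.1.1.2 = p.1.1.1 := congrArg (fun q : T => q.1.1) hp
        apply Subtype.ext
        apply Subtype.ext
        apply Prod.ext
        · rfl
        · exact h1.symm
      · intro x; rfl
    rw [e, Finset.card_filter]
    push_cast
    unfold mm ind
    refine Finset.sum_congr rfl fun p _ => ?_
    split_ifs <;> simp_all
  rw [c1, c2]
  exact (Int.natCast_modEq_iff).mpr this

lemma Cfg.bb_mod (h : Cfg n A) (g : G) :
    2 * (2 * n + 1) + bb A g + (2 * n - 2) * ind A g ≡ mm A g [ZMOD 3] := by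
  rw [← h.triple]; exact triple_mod g

end core
section cases
variable {G : Type*} [AddCommGroup G] [Fintype G] [DecidableEq G] {n : ℕ} {A : Finset G}

lemma ind_cases (x : G) : ind A x = 0 ∨ ind A x = 1 := by
  unfold ind; split_ifs <;> simp

lemma quad1 (b : ℤ) : (b - 3) * (b - 4) ≥ 0 := by
  rcases le_or_gt b 3 with h | h
  · nlinarith
  · have : b ≥ 4 := h
    nlinarith

lemma Cfg.case0 (h : Cfg n A) (hn : 2 ≤ n) (h3 : n % 3 = 0) : False := by
  have hs : ∀ g, (bb A g - 1) * (bb A g - 4) ≥ 2 * (ind A g * bb A g) - 8 * ind A g - 2 * mm A g +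
      ((bb A 0 - 4) * (bb A 0 - 3) + 2 * bb A 0) * (if g = 0 then 1 else 0) := by
    intro g
    by_cases hg : g = 0
    · subst hg
      rw [← h.bb_zero, h.ind_zero]; simp; nlinarith
    · have hm := mm_nonneg (A := A) g
      have hmod := h.bb_mod g
      have hq := quad1 (bb A g)
      simp only [hg, if_false, mul_zero, add_zero]
      rcases ind_cases (A := A) g with hi | hi <;> rw [hi] at hmod ⊢
      · by_cases h0 : mm A g = 0
        · have : bb A g % 3 = 1 := by unfold Int.ModEq at hmod; omega
          have : bb A g ≤ 1 ∨ 4 ≤ bb A g := by omega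
          rcases this with h' | h' <;> nlinarith
        · have : 1 ≤ mm A g := by omega
          have : bb A g ≤ 2 ∨ 3 ≤ bb A g := by omega
          nlinarith
      · nlinarith
  have := Finset.sum_le_sum (s := Finset.univ) (fun g _ => hs g)
  have e : ∀ g, (bb A g - 1) * (bb A g - 4) = bb A g ^ 2 - 5 * bb A g + 4 := fun g => by ring
  simp_rw [e] at this
  rw [Finset.sum_add_distrib, Finset.sum_add_distrib, Finset.sum_sub_distrib, Finset.sum_sub_distrib,
    Finset.sum_sub_distrib] at this
  simp_rw [← Finset.mul_sum] at this
  rw [h.sum_bb, h.sum_bb_sq, h.sum_mm, h.sum_ind, h.sum_ind_bb] at this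
  simp [h.cardG] at this
  have hn' : (2:ℤ) ≤ n := by exact_mod_cast hn
  nlinarith [sq_nonneg (bb A 0 - 3)]

lemma Cfg.case1 (h : Cfg n A) (hn : 2 ≤ n) (h3 : n % 3 = 1) : False := by
  have hs : ∀ g, (bb A g) * (bb A g - 3) ≥ 4 * (ind A g * bb A g) - 12 * ind A g - 2 * mm A g +
      2 * (ind A g * 0) +
      ((bb A 0) * (bb A 0 - 3) - 4 * bb A 0 + 12 + 2 * bb A 0) * (if g = 0 then 1 else 0) := by
    intro g
    by_cases hg : g = 0
    · subst hg
      rw [← h.bb_zero, h.ind_zero, if_pos rfl]; linarith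
    · have hm := mm_nonneg (A := A) g
      have hmod := h.bb_mod g
      have hq := quad1 (bb A g)
      simp only [hg, if_false, mul_zero, add_zero]
      rcases ind_cases (A := A) g with hi | hi <;> rw [hi] at hmod ⊢
      · by_cases h0 : mm A g = 0
        · have : bb A g % 3 = 0 := by unfold Int.ModEq at hmod; omega
          have : bb A g ≤ 0 ∨ 3 ≤ bb A g := by omega
          rcases this with h' | h' <;> nlinarith
        · have : 1 ≤ mm A g := by omega
          have : bb A g ≤ 1 ∨ 2 ≤ bb A g := by omega
          rcases this with h' | h' <;> nlinarith
      · nlinarith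
  have := Finset.sum_le_sum (s := Finset.univ) (fun g _ => hs g)
  have e : ∀ g, (bb A g) * (bb A g - 3) = bb A g ^ 2 - 3 * bb A g := fun g => by ring
  simp_rw [e, mul_zero, add_zero] at this
  rw [Finset.sum_add_distrib, Finset.sum_sub_distrib, Finset.sum_sub_distrib,
    Finset.sum_sub_distrib] at this
  simp_rw [← Finset.mul_sum] at this
  rw [h.sum_bb, h.sum_bb_sq, h.sum_mm, h.sum_ind, h.sum_ind_bb] at this
  simp at this
  have hn' : (2:ℤ) ≤ n := by exact_mod_cast hn
  nlinarith [sq_nonneg (bb A 0 - 3)]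

lemma Cfg.mm_le_bb (g : G) : mm A g ≤ bb A g := by
  refine Finset.sum_le_sum fun x _ => ?_
  by_cases hx : x + x + x = g
  · have : g - (x + x) = x := by rw [← hx]; abel
    rw [this, ind_mul_self]; simp [hx]
  · simp only [hx, if_false, mul_zero]; exact mul_nonneg (ind_nonneg _) (ind_nonneg _)

lemma Cfg.out2 (h : Cfg n A) (h3 : n % 3 = 2) (g : G) (hg : g ∉ A) : bb A g = 2 := by
  have h2 : ∀ g, 0 ≤ (1 - ind A g) * (bb A g - 2) := by
    intro g
    rcases ind_cases (A := A) g with hi | hi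
    · have hmod := h.bb_mod g
      have h1 := Cfg.mm_le_bb (A := A) g
      have h0 := mm_nonneg (A := A) g
      rw [hi] at hmod ⊢
      unfold Int.ModEq at hmod
      omega
    · simp [hi]
  have hs : ∑ g, (1 - ind A g) * (bb A g - 2) = 0 := by
    have e : ∀ g, (1 - ind A g) * (bb A g - 2) = bb A g - 2 + 2 * ind A g - ind A g * bb A g := fun g => by ring
    simp_rw [e]
    rw [Finset.sum_sub_distrib, Finset.sum_add_distrib, Finset.sum_sub_distrib, ← Finset.mul_sum,
      h.sum_bb, h.sum_ind, h.sum_ind_bb]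
    simp [h.cardG]; ring
  have := (Finset.sum_eq_zero_iff_of_nonneg (fun g _ => h2 g)).mp hs g (Finset.mem_univ _)
  simp [ind, hg] at this
  linarith

def NN (A : Finset G) (a : G) : Finset G :=
  A.filter (fun x => x ≠ 0 ∧ x ≠ a ∧ x + x - a ∈ A ∧ x + x - a ≠ 0)

def ee (a : G) : ℤ := if a + a + a = 0 then 1 else 0

def X1 (A : Finset G) : Finset G := A.filter (fun x => x + x + x ≠ 0)

lemma Cfg.bb_le (h : Cfg n A) (a : G) (ha : a ∈ A) (ha0 : a ≠ 0) :
    bb A a ≤ 2 + ((NN A a).card : ℤ) + ee a := by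
  have key : ∀ x, ind A x * ind A (a - (x + x)) ≤ (if x = 0 then (1:ℤ) else 0) + (if x = a then 1 else 0)
      + (if x ∈ NN A a then 1 else 0) + (if x = -a then ee a else 0) := by
    intro x
    have hpos : 0 ≤ (if x = -a then ee a else 0) := by unfold ee; split_ifs <;> simp
    have hpn : ∀ (p : Prop) [Decidable p], (0:ℤ) ≤ if p then 1 else 0 := by
      intro p _; split_ifs <;> simp
    by_cases hx : x ∈ A
    · by_cases hy : a - (x + x) ∈ A
      · have hL : ind A x * ind A (a - (x + x)) = 1 := by simp [ind, hx, hy]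
        rw [hL]
        have hy' : x + x - a ∈ A := by simpa using h.neg _ hy
        by_cases e0 : x = 0
        · rw [if_pos e0]; linarith [hpn (x = a), hpn (x ∈ NN A a)]
        by_cases e1 : x = a
        · rw [if_pos e1]; linarith [hpn (x = 0), hpn (x ∈ NN A a)]
        by_cases e2 : x + x - a = 0
        · have ea : x + x = a := sub_eq_zero.mp e2
          have := h.ind_mul_dbl x
          rw [ea] at this
          have h3 : a + x = 0 := by
            by_contra hc
            simp [ind, hx, ha, hc] at this
          have hxa : x = -a := (neg_eq_of_add_eq_zero_right h3).symm
          have : a + a + a = 0 := by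
            have : a + a + a = (x + x) + a + a := by rw [ea]
            rw [this, hxa]; abel
          have : ee a = 1 := by simp [ee, this]
          rw [if_neg e0, if_neg e1, if_pos hxa, this]
          split_ifs <;> simp
        · have : x ∈ NN A a := by simp [NN, hx, e0, e1, hy', e2]
          rw [if_neg e0, if_neg e1, if_pos this]
          linarith
      · have hL : ind A x * ind A (a - (x + x)) = 0 := by simp [ind, hy]
        rw [hL]
        have : ∀ (p : Prop) [Decidable p], (0:ℤ) ≤ if p then 1 else 0 := by
          intro p _; split_ifs <;> simp
        linarith [this (x = 0), this (x = a), this (x ∈ NN A a)]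
    · have hL : ind A x * ind A (a - (x + x)) = 0 := by simp [ind, hx]
      rw [hL]
      have : ∀ (p : Prop) [Decidable p], (0:ℤ) ≤ if p then 1 else 0 := by
        intro p _; split_ifs <;> simp
      linarith [this (x = 0), this (x = a), this (x ∈ NN A a)]
  have := Finset.sum_le_sum (s := Finset.univ) (fun x _ => key x)
  simp [Finset.sum_add_distrib] at this
  unfold bb
  linarith

lemma Cfg.two_le_bb (h : Cfg n A) (a : G) (ha : a ∈ A) (ha0 : a ≠ 0) : 2 ≤ bb A a := by
  have key : ∀ x, (if x = 0 then (1:ℤ) else 0) + (if x = a then 1 else 0) ≤ ind A x * ind A (a - (x + x)) := by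
    intro x
    by_cases e0 : x = 0
    · subst e0; simp [ind, h.zero, ha, ha0.symm]
    by_cases e1 : x = a
    · subst e1; simp [ind, h.neg, ha, ha0]
    · simp only [e0, e1, if_false, add_zero]; exact mul_nonneg (ind_nonneg _) (ind_nonneg _)
  have := Finset.sum_le_sum (s := Finset.univ) (fun x _ => key x)
  simp [Finset.sum_add_distrib] at this
  unfold bb
  linarith

lemma Cfg.dbl_ne (h : Cfg n A) {x : G} (hx : x ≠ 0) : x + x ≠ 0 := fun e =>
  hx (h.dbl_inj (by simpa using e))

lemma Cfg.nn_pair (h : Cfg n A) {u w x : G} (hu : u ∈ A) (hw : w ∈ A) (huw : u ≠ w)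
    (h1 : x ∈ NN A u) (h2 : x ∈ NN A w) : x + x = u + w := by
  simp only [NN, Finset.mem_filter] at h1 h2
  obtain ⟨hx, hx0, hxu, hp, hp0⟩ := h1
  obtain ⟨_, _, hxw, hq, hq0⟩ := h2
  have a1 : u ≠ x + x - u := fun e => hxu (h.dbl_inj (eq_sub_iff_add_eq.mp e).symm)
  have a2 : w ≠ x + x - w := fun e => hxw (h.dbl_inj (eq_sub_iff_add_eq.mp e).symm)
  have := h.uniq u hu _ hp w hw _ hq a1 a2 (by abel) (by
    have : u + (x + x - u) = x + x := by abel
    rw [this]; exact h.dbl_ne hx0)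
  rcases this with ⟨e, _⟩ | ⟨e, _⟩
  · exact absurd e.symm huw
  · rw [e]; abel

lemma Cfg.nn_sub (h : Cfg n A) {u : G} (hu : u ∈ A) (hu0 : u ≠ 0) : NN A u ⊆ X1 A := by
  intro x h1
  simp only [NN, X1, Finset.mem_filter] at h1 ⊢
  obtain ⟨hx, hx0, hxu, hp, hp0⟩ := h1
  refine ⟨hx, fun h3 => ?_⟩
  have a1 : u ≠ x + x - u := fun e => hxu (h.dbl_inj (eq_sub_iff_add_eq.mp e).symm)
  have e1 : u + (x + x - u) = x + x := by abel
  have e2 : x + x = -x := eq_neg_of_add_eq_zero_left h3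
  have := h.uniq u hu _ hp 0 h.zero (-x) (h.neg _ hx) a1 (by simpa using hx0) (by rw [e1, e2]; simp)
    (by rw [e1]; exact h.dbl_ne hx0)
  rcases this with ⟨e, _⟩ | ⟨e, _⟩
  · exact hu0 e.symm
  · exact hp0 e.symm

lemma Cfg.nn_neg (h : Cfg n A) (u : G) : (NN A (-u)).card = (NN A u).card := by
  refine Finset.card_bij' (fun x _ => -x) (fun x _ => -x) ?_ ?_ ?_ ?_
  · intro x hx
    simp only [NN, Finset.mem_filter] at hx ⊢
    obtain ⟨hx, hx0, hxu, hp, hp0⟩ := hx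
    have e : -x + -x - u = -(x + x - -u) := by abel
    refine ⟨h.neg _ hx, by simpa using hx0, fun e => hxu (by rw [← e]; simp), ?_, ?_⟩
    · rw [e]; exact h.neg _ hp
    · rw [e]; exact neg_ne_zero.mpr hp0
  · intro x hx
    simp only [NN, Finset.mem_filter] at hx ⊢
    obtain ⟨hx, hx0, hxu, hp, hp0⟩ := hx
    have e : -x + -x - -u = -(x + x - u) := by abel
    refine ⟨h.neg _ hx, by simpa using hx0, by simpa using hxu, ?_, ?_⟩
    · rw [e]; exact h.neg _ hp
    · rw [e]; exact neg_ne_zero.mpr hp0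
  · intro x _; simp
  · intro x _; simp

lemma Cfg.ne_neg (h : Cfg n A) {u : G} (hu0 : u ≠ 0) : u ≠ -u := fun e =>
  h.dbl_ne hu0 (add_eq_zero_iff_eq_neg.mpr e)

lemma Cfg.nn_disj (h : Cfg n A) {u : G} (hu : u ∈ A) (hu0 : u ≠ 0) : Disjoint (NN A u) (NN A (-u)) := by
  rw [Finset.disjoint_left]
  intro x h1 h2
  have := h.nn_pair hu (h.neg _ hu) (h.ne_neg hu0) h1 h2
  simp only [NN, Finset.mem_filter] at h1
  exact h.dbl_ne h1.2.1 (by rw [this]; abel)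

lemma Cfg.nn_union_card (h : Cfg n A) {u : G} (hu : u ∈ A) (hu0 : u ≠ 0) :
    (NN A u ∪ NN A (-u)).card = 2 * (NN A u).card := by
  rw [Finset.card_union_of_disjoint (h.nn_disj hu hu0), h.nn_neg]; ring

lemma Cfg.nn_union_sub (h : Cfg n A) {u : G} (hu : u ∈ A) (hu0 : u ≠ 0) :
    NN A u ∪ NN A (-u) ⊆ X1 A :=
  Finset.union_subset (h.nn_sub hu hu0) (h.nn_sub (h.neg _ hu) (by simpa using hu0))

lemma Cfg.nn_le (h : Cfg n A) {u : G} (hu : u ∈ A) (hu0 : u ≠ 0) :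
    2 * (NN A u).card ≤ (X1 A).card := by
  rw [← h.nn_union_card hu hu0]
  exact Finset.card_le_card (h.nn_union_sub hu hu0)

lemma Cfg.nn_le2 (h : Cfg n A) {u w : G} (hu : u ∈ A) (hu0 : u ≠ 0) (hw : w ∈ A) (hw0 : w ≠ 0)
    (h1 : u ≠ w) (h2 : u ≠ -w) : 2 * ((NN A u).card + (NN A w).card) ≤ (X1 A).card + 4 := by
  have e := Finset.card_union_add_card_inter (NN A u ∪ NN A (-u)) (NN A w ∪ NN A (-w))
  rw [h.nn_union_card hu hu0, h.nn_union_card hw hw0] at e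
  have c1 := Finset.card_le_card (Finset.union_subset (h.nn_union_sub hu hu0) (h.nn_union_sub hw hw0))
  have c2 : ((NN A u ∪ NN A (-u)) ∩ (NN A w ∪ NN A (-w))).card ≤ 4 := by
    calc _ ≤ ({u + w, u + -w, -u + w, -u + -w} : Finset G).card := by
          refine Finset.card_le_card_of_injOn (fun x => x + x) ?_ (h.dbl_inj.injOn)
          intro x hx
          simp only [Finset.coe_inter, Finset.coe_union, Set.mem_inter_iff, Set.mem_union, Finset.mem_coe] at hx
          have h1' : -u ≠ -w := fun e => h1 (neg_injective e)
          have h2' : -u ≠ w := fun e => h2 (by rw [← e]; simp)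
          have nu := h.neg _ hu
          have nw := h.neg _ hw
          simp only [Finset.coe_insert, Finset.coe_singleton, Set.mem_insert_iff, Set.mem_singleton_iff]
          rcases hx with ⟨a | a, b | b⟩
          · exact Or.inl (h.nn_pair hu hw h1 a b)
          · exact Or.inr (Or.inl (h.nn_pair hu nw h2 a b))
          · exact Or.inr (Or.inr (Or.inl (h.nn_pair nu hw h2' a b)))
          · exact Or.inr (Or.inr (Or.inr (h.nn_pair nu nw h1' a b)))
      _ ≤ 4 := Finset.card_le_four
  omega

lemma Cfg.fiber (h : Cfg n A) (x : G) :
    2 * ∑ a ∈ A.erase 0, (if x ∈ NN A a then ((NN A a).card : ℤ) else 0) ≤ (X1 A).card + 4 := by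
  rw [← Finset.sum_filter]
  by_cases he : ∃ u ∈ A.erase 0, x ∈ NN A u
  · obtain ⟨u, hu, hxu⟩ := he
    obtain ⟨hu0, huA⟩ := Finset.mem_erase.mp hu
    have hxu' := hxu
    simp only [NN, Finset.mem_filter] at hxu'
    obtain ⟨_, hx0, hne, hwA, hw0⟩ := hxu'
    set w := x + x - u with hw
    have huw : u ≠ w := fun e => hne (h.dbl_inj (eq_sub_iff_add_eq.mp e).symm)
    have huw2 : u ≠ -w := fun e => h.dbl_ne hx0 (by
      have : x + x = u + w := by rw [hw]; abel
      rw [this]; exact add_eq_zero_iff_eq_neg.mpr e)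
    have hsub : (A.erase 0).filter (fun a => x ∈ NN A a) ⊆ {u, w} := by
      intro a ha
      rw [Finset.mem_filter, Finset.mem_erase] at ha
      rw [Finset.mem_insert, Finset.mem_singleton]
      by_cases hau : a = u
      · exact Or.inl hau
      · right
        have := h.nn_pair huA ha.1.2 (Ne.symm hau) hxu ha.2
        rw [hw, this]; abel
    have := Finset.sum_le_sum_of_subset_of_nonneg (f := fun a => ((NN A a).card : ℤ)) hsub
      (fun i _ _ => by positivity)
    rw [Finset.sum_pair huw] at this
    have h2 := h.nn_le2 huA hu0 hwA hw0 huw huw2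
    have h2' : 2 * (((NN A u).card : ℤ) + (NN A w).card) ≤ (X1 A).card + 4 := by exact_mod_cast h2
    linarith
  · push Not at he
    rw [Finset.filter_false_of_mem he]
    simp; positivity

lemma Cfg.sum_k_sq (h : Cfg n A) :
    2 * ∑ a ∈ A.erase 0, ((NN A a).card : ℤ) ^ 2 ≤ (X1 A).card * ((X1 A).card + 4) := by
  have e : ∀ a ∈ A.erase 0, ((NN A a).card : ℤ) ^ 2 = ∑ x ∈ X1 A, (if x ∈ NN A a then ((NN A a).card : ℤ) else 0) := by
    intro a ha
    obtain ⟨hu0, huA⟩ := Finset.mem_erase.mp ha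
    rw [← Finset.sum_filter, Finset.sum_const, Finset.filter_mem_eq_inter,
      Finset.inter_eq_right.mpr (h.nn_sub huA hu0)]
    simp [sq]
  rw [Finset.sum_congr rfl e, Finset.sum_comm, Finset.mul_sum]
  refine (Finset.sum_le_sum (fun x _ => h.fiber x)).trans ?_
  simp

lemma mm_zero_eq : mm A 0 = ((A.filter (fun x => x + x + x = 0)).card : ℤ) := by
  unfold mm ind
  rw [Finset.card_filter]
  push_cast
  rw [← Finset.sum_filter_add_sum_filter_not Finset.univ (fun x => x ∈ A)]
  rw [Finset.sum_eq_zero (s := Finset.univ.filter (fun x => ¬ x ∈ A))]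
  · simp only [Finset.filter_univ_mem, add_zero]
    exact Finset.sum_congr rfl (fun x hx => by simp [hx])
  · intro x hx
    simp at hx
    simp [hx]

lemma Cfg.X1_card (h : Cfg n A) : ((X1 A).card : ℤ) = 2 * n + 1 - mm A 0 := by
  have := Finset.card_filter_add_card_filter_not (s := A) (fun x => x + x + x = 0)
  rw [h.card] at this
  rw [mm_zero_eq]
  unfold X1
  have : (((A.filter (fun x => x + x + x = 0)).card + (A.filter (fun x => ¬ x + x + x = 0)).card : ℕ) : ℤ) = 2 * n + 1 := by
    rw [this]; push_cast; ring
  push_cast at this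
  simp only [ne_eq]
  linarith

lemma Cfg.sum_ee (h : Cfg n A) : ∑ a ∈ A.erase 0, ee a = mm A 0 - 1 := by
  have : ∑ a ∈ A, ee a = mm A 0 := by
    rw [mm_zero_eq, Finset.card_filter]; push_cast; rfl
  rw [← this, ← Finset.add_sum_erase A _ h.zero]
  simp [ee]

lemma Cfg.case2 (h : Cfg n A) (h3 : n % 3 = 2) (hn : 5 ≤ n) : X1 A = ∅ := by
  have tot : ∑ g, (bb A g - 2) ^ 2 = 4 * n ^ 2 - 4 * n + mm A 0 := by
    have e : ∀ g, (bb A g - 2) ^ 2 = bb A g ^ 2 - 4 * bb A g + 4 := fun g => by ring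
    simp_rw [e]
    rw [Finset.sum_add_distrib, Finset.sum_sub_distrib, ← Finset.mul_sum, h.sum_bb, h.sum_bb_sq, h.bb_zero]
    simp [h.cardG]; ring
  have spl : ∑ g, (bb A g - 2) ^ 2 = (mm A 0 - 2) ^ 2 + ∑ a ∈ A.erase 0, (bb A a - 2) ^ 2 := by
    rw [← h.bb_zero, Finset.add_sum_erase A (fun a => (bb A a - 2) ^ 2) h.zero]
    symm
    refine Finset.sum_subset (Finset.subset_univ _) fun x _ hx => ?_
    rw [h.out2 h3 x hx]; simp
  have bd : ∑ a ∈ A.erase 0, (bb A a - 2) ^ 2 ≤ ∑ a ∈ A.erase 0, (((NN A a).card : ℤ) ^ 2 + (X1 A).card * ee a + ee a) := by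
    refine Finset.sum_le_sum fun a ha => ?_
    obtain ⟨hu0, huA⟩ := Finset.mem_erase.mp ha
    have b1 := h.bb_le a huA hu0
    have b2 := h.two_le_bb a huA hu0
    have b3 : 2 * ((NN A a).card : ℤ) ≤ (X1 A).card := by exact_mod_cast h.nn_le huA hu0
    have b4 : 0 ≤ ((NN A a).card : ℤ) := by positivity
    have b5 : ee a = 0 ∨ ee a = 1 := by unfold ee; split_ifs <;> simp
    rcases b5 with b5 | b5 <;> rw [b5] at b1 ⊢ <;> nlinarith
  rw [Finset.sum_add_distrib, Finset.sum_add_distrib, ← Finset.mul_sum, h.sum_ee] at bd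
  have sk := h.sum_k_sq
  have hX := h.X1_card
  by_contra hne
  have hpos : 1 ≤ (X1 A).card := Finset.card_pos.mpr (Finset.nonempty_iff_ne_empty.mpr hne)
  have hpos' : (1:ℤ) ≤ (X1 A).card := by exact_mod_cast hpos
  have ht : 1 ≤ mm A 0 := by
    rw [mm_zero_eq]
    have : 0 < (A.filter (fun x => x + x + x = 0)).card := Finset.card_pos.mpr ⟨0, by simp [h.zero]⟩
    exact_mod_cast this
  have hn' : (5:ℤ) ≤ n := by exact_mod_cast hn
  generalize ((X1 A).card : ℤ) = E at *
  generalize mm A 0 = t at *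
  generalize ∑ a ∈ A.erase 0, ((NN A a).card : ℤ) ^ 2 = S at *
  have et : t = 2 * n + 1 - E := by linarith
  have key : E * (E + 2 * (t - 1) - 8) ≤ 0 := by
    have hN : 2 * (n : ℤ) = E + (t - 1) := by linarith
    have : (4 * (n:ℤ) ^ 2 - 4 * n) = (E + (t - 1)) ^ 2 - 2 * (E + (t - 1)) := by rw [← hN]; ring
    rw [this] at tot
    nlinarith
  nlinarith

end cases
section final
variable {G : Type*} [AddCommGroup G] [Fintype G] [DecidableEq G] {n : ℕ} {A : Finset G}

def psi (y : ZMod 3) : ℤ := if y = 0 then 2 else -1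

lemma psi_mul (x y : ZMod 3) : psi x * psi y = psi (x + y) + psi (x + -y) := by
  revert x y; decide

lemma psi_dbl (x : ZMod 3) : psi (x + x) = psi x := by
  revert x; decide

lemma psi_sum (x : ZMod 3) : psi x + psi (x + 1) + psi (x + 1 + 1) = 0 := by
  revert x; decide

lemma Cfg.square (h : Cfg n A) (φ : G →+ ZMod 3) (g₀ : G) (hg : φ g₀ = 1) :
    ∃ s : ℕ, s ^ 2 + 7 = 8 * n := by
  set Z := ∑ x, ind A x * psi (φ x) with hZ
  have s0 : ∑ g, psi (φ g) = 0 := by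
    have e1 : ∑ g, psi (φ g + 1) = ∑ g, psi (φ g) := by
      rw [← Equiv.sum_comp (Equiv.addRight g₀) (fun g => psi (φ g))]
      simp [hg]
    have e2 : ∑ g, psi (φ g + 1 + 1) = ∑ g, psi (φ g) := by
      rw [← e1, ← Equiv.sum_comp (Equiv.addRight g₀) (fun g => psi (φ g + 1))]
      simp [hg]
    have : ∑ g, (psi (φ g) + psi (φ g + 1) + psi (φ g + 1 + 1)) = 0 :=
      Finset.sum_eq_zero fun g _ => psi_sum _
    rw [Finset.sum_add_distrib, Finset.sum_add_distrib, e1, e2] at this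
    linarith
  have key : Z * Z = 2 * ∑ g, rr A g * psi (φ g) := by
    have e1 : ∑ x, ∑ y, ind A x * ind A y * psi (φ x + φ y) = ∑ g, rr A g * psi (φ g) := by
      unfold rr
      simp_rw [Finset.sum_mul]
      rw [Finset.sum_comm (s := (Finset.univ : Finset G)) (f := fun g x => ind A x * ind A (g - x) * psi (φ g))]
      refine Finset.sum_congr rfl fun x _ => ?_
      rw [← Equiv.sum_comp (Equiv.addLeft x) (fun g => ind A x * ind A (g - x) * psi (φ g))]
      refine Finset.sum_congr rfl fun y _ => ?_
      simp
    have e2 : ∑ x, ∑ y, ind A x * ind A y * psi (φ x + -φ y) = ∑ x, ∑ y, ind A x * ind A y * psi (φ x + φ y) := by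
      refine Finset.sum_congr rfl fun x _ => ?_
      rw [← Equiv.sum_comp (Equiv.neg G)]
      refine Finset.sum_congr rfl fun y _ => ?_
      simp [h.ind_neg]
    rw [hZ, Finset.sum_mul_sum]
    have e3 : ∀ x y, ind A x * psi (φ x) * (ind A y * psi (φ y)) =
        ind A x * ind A y * psi (φ x + φ y) + ind A x * ind A y * psi (φ x + -φ y) := by
      intro x y
      rw [← mul_add, ← psi_mul]; ring
    simp_rw [e3, Finset.sum_add_distrib]
    rw [e2, e1]; ring
  rw [← h.sum_dbl] at key
  simp_rw [h.rr_dbl, map_add, psi_dbl, add_mul, Finset.sum_add_distrib] at key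
  simp_rw [mul_assoc, ← Finset.mul_sum, s0, ← hZ] at key
  have p0 : psi 0 = 2 := rfl
  simp [p0] at key
  refine ⟨(Z - 1).natAbs, ?_⟩
  zify
  rw [sq_abs]
  linarith

lemma exists_hom (h3 : ∀ g : G, g + g + g = 0) (x : G) (hx : x ≠ 0) :
    ∃ (φ : G →+ ZMod 3) (g₀ : G), φ g₀ = 1 := by
  have : Fact (Nat.Prime 3) := ⟨Nat.prime_three⟩
  let _ : Module (ZMod 3) G := AddCommGroup.zmodModule (n := 3) (fun g => by
    rw [← h3 g, succ_nsmul, two_nsmul])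
  have := (Module.forall_dual_apply_eq_zero_iff (ZMod 3) x).not.mpr hx
  push Not at this
  obtain ⟨φ, hφ⟩ := this
  refine ⟨φ.toAddMonoidHom, (φ x)⁻¹ • x, ?_⟩
  show φ ((φ x)⁻¹ • x) = 1
  rw [map_smul, smul_eq_mul, inv_mul_cancel₀ hφ]

lemma card_pow (h3 : ∀ g : G, g + g + g = 0) : ∃ k, Fintype.card G = 3 ^ k := by
  have : Fact (Nat.Prime 3) := ⟨Nat.prime_three⟩
  have hp : IsPGroup 3 (Multiplicative G) := by
    intro g
    refine ⟨1, ?_⟩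
    have : (3 : ℕ) • (Multiplicative.toAdd g) = 0 := by
      rw [succ_nsmul, two_nsmul]; exact h3 _
    rw [pow_one, ← ofAdd_toAdd (g ^ 3), toAdd_pow, this, ofAdd_zero]
  obtain ⟨k, hk⟩ := IsPGroup.iff_card.mp hp
  refine ⟨k, ?_⟩
  rw [← hk, Nat.card_eq_fintype_card, Fintype.card_multiplicative]

lemma small_dvd (X k : ℕ) (h : X ∣ 32 * 3 ^ k) (h27 : ¬ 27 ∣ X) : X ≤ 288 := by
  obtain ⟨a, b, ha, hb, rfl⟩ := Nat.dvd_mul.mp h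
  obtain ⟨j, _, rfl⟩ := (Nat.dvd_prime_pow Nat.prime_three).mp hb
  have hj : j ≤ 2 := by
    by_contra hc
    apply h27
    exact Dvd.dvd.mul_left (pow_dvd_pow 3 (by omega : 3 ≤ j)) a
  have h1 : a ≤ 32 := Nat.le_of_dvd (by norm_num) ha
  have h2 : 3 ^ j ≤ 3 ^ 2 := Nat.pow_le_pow_right (by norm_num) hj
  calc a * 3 ^ j ≤ 32 * 3 ^ 2 := Nat.mul_le_mul h1 h2
    _ = 288 := by norm_num

lemma numth (n s k : ℕ) (hn : 3 ≤ n) (h3 : n % 3 = 2) (hs : s ^ 2 + 7 = 8 * n) (hk : 2 * n ^ 2 + 1 = 3 ^ k) :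
    n = 11 := by
  have hs1 : 2 ≤ s := by nlinarith
  obtain ⟨r, rfl⟩ : ∃ r, s = r + 1 := ⟨s - 1, by omega⟩
  have hprod : (r ^ 2 + 8) * ((r + 2) ^ 2 + 8) = 32 * 3 ^ k := by
    rw [← hk]
    zify at hs ⊢
    have : (n : ℤ) * 8 = (r + 1) ^ 2 + 7 := by linarith
    have e : 32 * (2 * (n:ℤ) ^ 2 + 1) = (n * 8) ^ 2 + 32 := by ring
    rw [e, this]; ring
  have hb : r ^ 2 + 8 ≤ 288 := by
    by_cases h27 : 27 ∣ r ^ 2 + 8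
    · have : ¬ 27 ∣ (r + 2) ^ 2 + 8 := by
        intro h'
        have e : r % 27 < 27 := Nat.mod_lt _ (by norm_num)
        have h1 : (r ^ 2 + 8) % 27 = 0 := Nat.mod_eq_zero_of_dvd h27
        have h2 : ((r + 2) ^ 2 + 8) % 27 = 0 := Nat.mod_eq_zero_of_dvd h'
        rw [Nat.add_mod, Nat.pow_mod] at h1 h2
        rw [Nat.add_mod r 2] at h2
        generalize r % 27 = q at *
        interval_cases q <;> simp_all
      have := small_dvd _ k (hprod ▸ Dvd.intro_left _ rfl) this
      nlinarith
    · exact small_dvd _ k (hprod ▸ Dvd.intro _ rfl) h27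
  have hr : r ≤ 16 := by nlinarith
  have hn38 : n ≤ 37 := by nlinarith
  have hk7 : k < 8 := by
    by_contra hc
    have : 3 ^ 8 ≤ 3 ^ k := Nat.pow_le_pow_right (by norm_num) (by omega)
    nlinarith
  interval_cases r <;> first | omega | (interval_cases k <;> omega)

lemma Cfg.main (h : Cfg n A) (hn : 3 ≤ n) : n = 11 := by
  have : n % 3 = 0 ∨ n % 3 = 1 ∨ n % 3 = 2 := by omega
  rcases this with h3 | h3 | h3
  · exact (h.case0 (by omega) h3).elim
  · exact (h.case1 (by omega) h3).elim
  · have hX := h.case2 h3 (by omega)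
    have hA : ∀ a ∈ A, a + a + a = 0 := by
      intro a ha
      by_contra hc
      have : a ∈ X1 A := by simp [X1, ha, hc]
      rw [hX] at this
      simp at this
    have hG : ∀ g : G, g + g + g = 0 := by
      intro g
      by_cases hg : g = 0
      · simp [hg]
      · obtain ⟨p, hp, q, hq, _, rfl⟩ := h.ex g hg
        have : p + q + (p + q) + (p + q) = (p + p + p) + (q + q + q) := by abel
        rw [this, hA p hp, hA q hq, add_zero]
    have hx : ∃ x : G, x ≠ 0 := by
      by_contra hc
      push Not at hc
      have := h.cardG'
      have h1 : Fintype.card G ≤ 1 := Fintype.card_le_one_iff.mpr (fun a b => by rw [hc a, hc b])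
      nlinarith
    obtain ⟨x, hx⟩ := hx
    obtain ⟨φ, g₀, hφ⟩ := exists_hom hG x hx
    obtain ⟨s, hs⟩ := h.square φ g₀ hφ
    obtain ⟨k, hk⟩ := card_pow hG
    exact numth n s k hn h3 hs (by rw [← h.cardG', hk])

end final
def sg (b : Bool) : ℤ := if b then 1 else -1

lemma sg_cases (b : Bool) : sg b = 1 ∨ sg b = -1 := by cases b <;> simp [sg]

lemma sg_not (b : Bool) : sg (!b) = - sg b := by cases b <;> simp [sg]

lemma sg_inj {b c : Bool} (h : sg b = sg c) : b = c := by
  revert h; cases b <;> cases c <;> simp [sg]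

def vec {n : ℕ} : Option (Fin n × Bool) → (Fin n → ℤ)
  | none => 0
  | some p => Pi.single p.1 (sg p.2)

lemma vec_inj {n : ℕ} : Function.Injective (vec (n := n)) := by
  rintro (_ | ⟨i, b⟩) (_ | ⟨j, c⟩) h
  · rfl
  · have := congrFun h j
    simp [vec] at this
    rcases sg_cases c with e | e <;> rw [e] at this <;> simp at this
  · have := congrFun h i
    simp [vec] at this
    rcases sg_cases b with e | e <;> rw [e] at this <;> simp at this
  · have := congrFun h i
    simp only [vec, Pi.single_eq_same, Pi.single_apply] at this
    by_cases hij : i = j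
    · subst hij
      simp at this
      rw [sg_inj this]
    · simp [hij] at this
      rcases sg_cases b with e | e <;> rw [e] at this <;> simp at this

lemma vec_neg {n : ℕ} (o : Option (Fin n × Bool)) : ∃ o', vec o' = - vec o := by
  rcases o with _ | ⟨i, b⟩
  · exact ⟨none, by simp [vec]⟩
  · exact ⟨some (i, !b), by simp [vec, sg_not, Pi.single_neg]⟩

lemma vec_sum_mem {n : ℕ} (o o' : Option (Fin n × Bool)) (hne : o ≠ o') : vec o + vec o' ∈ errBall n := by
  have hz : (0 : Fin n → ℤ) ∈ errBall n := by simp [errBall]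
  have hs : ∀ (i : Fin n) b, Pi.single i (sg b) ∈ errBall n := by
    intro i b
    refine ⟨fun j => ?_, ?_⟩
    · by_cases h : j = i
      · subst h; rcases sg_cases b with e | e <;> simp [e]
      · simp [h]
    · refine (Finset.card_le_card (t := {i}) ?_).trans (by simp)
      intro j hj
      by_contra hc
      simp at hc
      simp [hc] at hj
  rcases o with _ | ⟨i, b⟩ <;> rcases o' with _ | ⟨j, c⟩
  · exact absurd rfl hne
  · simpa [vec] using hs j c
  · simpa [vec] using hs i b
  · by_cases hij : i = j
    · subst hij
      have hbc : c = !b := by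
        cases b <;> cases c <;> simp_all
      simp only [vec, hbc, sg_not, Pi.single_neg, add_neg_cancel]
      exact hz
    · refine ⟨fun k => ?_, ?_⟩
      · simp only [vec, Pi.add_apply, Pi.single_apply]
        by_cases h : k = i
        · subst h; rcases sg_cases b with e | e <;> simp [e, hij]
        · rcases sg_cases c with e | e <;> simp [h, e] <;> by_cases h' : k = j <;> simp [h']
      · refine (Finset.card_le_card (t := {i, j}) ?_).trans Finset.card_le_two
        intro k hk
        by_contra hc
        simp at hc
        rw [Finset.mem_filter] at hk
        exact hk.2 (by simp [vec, Pi.single_apply, hc.1, hc.2])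

lemma vec_mem {n : ℕ} (o : Option (Fin n × Bool)) : vec o ∈ errBall n := by
  rcases o with _ | p
  · simp [vec, errBall]
  · simpa [vec] using vec_sum_mem (some p) none (by simp)

lemma neg_mem_ball {n : ℕ} {v : Fin n → ℤ} (h : v ∈ errBall n) : -v ∈ errBall n := by
  refine ⟨fun i => ?_, ?_⟩
  · rcases h.1 i with e | e | e <;> simp [e]
  · simpa using h.2

lemma errBall_eq {n : ℕ} {v : Fin n → ℤ} (h : v ∈ errBall n) (hv : v ≠ 0) :
    ∃ o o', o ≠ o' ∧ v = vec o + vec o' := by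
  obtain ⟨h1, h2⟩ := h
  have hsg : ∀ i, v i ≠ 0 → ∃ b, v i = sg b := by
    intro i hi
    rcases h1 i with e | e | e
    · exact ⟨false, by simp [sg, e]⟩
    · exact absurd e hi
    · exact ⟨true, by simp [sg, e]⟩
  have hcard : (Finset.univ.filter (fun i => v i ≠ 0)).card = 0 ∨ (Finset.univ.filter (fun i => v i ≠ 0)).card = 1 ∨
     (Finset.univ.filter (fun i => v i ≠ 0)).card = 2 := by omega
  rcases hcard with h | h | h
  · exfalso; apply hv
    rw [Finset.card_eq_zero, Finset.filter_eq_empty_iff] at h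
    funext i
    simpa using h (Finset.mem_univ i)
  · obtain ⟨i, hi⟩ := Finset.card_eq_one.mp h
    have mem : ∀ k, v k ≠ 0 ↔ k = i := fun k => by
      have := Finset.ext_iff.mp hi k
      simpa using this
    obtain ⟨b, hb⟩ := hsg i ((mem i).mpr rfl)
    refine ⟨some (i, b), none, by simp, ?_⟩
    funext k
    by_cases hk : k = i
    · subst hk; simp [vec, hb]
    · have : v k = 0 := by by_contra hc; exact hk ((mem k).mp hc)
      simp [vec, hk, this]
  · obtain ⟨i, j, hij, hi⟩ := Finset.card_eq_two.mp h
    have mem : ∀ k, v k ≠ 0 ↔ k = i ∨ k = j := fun k => by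
      have := Finset.ext_iff.mp hi k
      simpa using this
    obtain ⟨b, hb⟩ := hsg i ((mem i).mpr (Or.inl rfl))
    obtain ⟨c, hc⟩ := hsg j ((mem j).mpr (Or.inr rfl))
    refine ⟨some (i, b), some (j, c), by simp [hij], ?_⟩
    funext k
    by_cases hk : k = i
    · subst hk; simp [vec, hb, hij]
    · by_cases hk' : k = j
      · subst hk'; simp [vec, hc, hk]
      · have : v k = 0 := by
          by_contra hc
          rcases (mem k).mp hc with e | e
          · exact hk e
          · exact hk' e
        simp [vec, hk, hk', this]

lemma sg_ne (b : Bool) : (0:ℤ) ≠ sg b := by cases b <;> simp [sg]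

lemma vec_apply {n : ℕ} (o : Option (Fin n × Bool)) (i : Fin n) (b : Bool) :
    vec o i = sg b ↔ some (i, b) = o := by
  rcases o with _ | ⟨j, c⟩
  · simp [vec, sg_ne]
  · by_cases h : i = j
    · subst h
      simp only [vec, Pi.single_eq_same, Option.some.injEq, Prod.mk.injEq, true_and]
      exact ⟨fun h => (sg_inj h).symm, fun h => by rw [h]⟩
    · simp [vec, h, sg_ne]

lemma vec_mem_iff {n : ℕ} (o1 o2 : Option (Fin n × Bool)) (h12 : o1 ≠ o2)
    (h0 : vec o1 + vec o2 ≠ 0) (i : Fin n) (b : Bool) :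
    (vec o1 + vec o2) i = sg b ↔ (some (i, b) = o1 ∨ some (i, b) = o2) := by
  have hz : vec o1 i = 0 ∨ vec o2 i = 0 := by
    rcases o1 with _ | ⟨j, c⟩
    · left; rfl
    rcases o2 with _ | ⟨k, d⟩
    · right; rfl
    by_cases hj : i = j
    · by_cases hk : i = k
      · subst hj; subst hk
        exfalso; apply h0
        have hbc : d = !c := by
          cases d <;> cases c <;> simp_all
        simp [vec, hbc, sg_not, Pi.single_neg]
      · right; simp [vec, hk]
    · left; simp [vec, hj]
  rw [← vec_apply, ← vec_apply, Pi.add_apply]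
  have := sg_ne b
  rcases hz with e | e <;> rw [e] <;> simp [this]

lemma opt_pair {α : Type*} (o1 o2 o3 o4 : Option α) (h12 : o1 ≠ o2) (h34 : o3 ≠ o4)
    (H : ∀ p, (some p = o1 ∨ some p = o2) ↔ (some p = o3 ∨ some p = o4)) :
    (o3 = o1 ∧ o4 = o2) ∨ (o3 = o2 ∧ o4 = o1) := by
  have K : ∀ o : Option α, o ≠ none → ((o = o1 ∨ o = o2) ↔ (o = o3 ∨ o = o4)) := by
    rintro (_ | p) h
    · exact absurd rfl h
    · exact H p
  have k1 := K o1
  have k2 := K o2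
  have k3 := K o3
  have k4 := K o4
  clear K H
  grind

lemma vec_uniq {n : ℕ} (o1 o2 o3 o4 : Option (Fin n × Bool)) (h12 : o1 ≠ o2) (h34 : o3 ≠ o4)
    (he : vec o1 + vec o2 = vec o3 + vec o4) (h0 : vec o1 + vec o2 ≠ 0) :
    (o3 = o1 ∧ o4 = o2) ∨ (o3 = o2 ∧ o4 = o1) := by
  have h0' : vec o3 + vec o4 ≠ 0 := he ▸ h0
  have H : ∀ p, (some p = o1 ∨ some p = o2) ↔ (some p = o3 ∨ some p = o4) := by
    rintro ⟨i, b⟩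
    rw [← vec_mem_iff o1 o2 h12 h0, ← vec_mem_iff o3 o4 h34 h0', he]
  clear he h0 h0'
  exact opt_pair o1 o2 o3 o4 h12 h34 H

lemma tiling_cfg {n : ℕ} {L : AddSubgroup (Fin n → ℤ)} (hL : IsLatticeTiling n (errBall n) L)
    (hn : 3 ≤ n) : n = 11 := by
  classical
  let π : (Fin n → ℤ) →+ ((Fin n → ℤ) ⧸ L) := QuotientAddGroup.mk' L
  have T1 : ∀ u ∈ errBall n, ∀ v ∈ errBall n, π u = π v → u = v := by
    intro u hu v hv huv
    have hm : -v + u ∈ L := (QuotientAddGroup.eq).mp huv.symm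
    obtain ⟨p, _, hp⟩ := hL u
    have e1 := hp (u, 0) ⟨hu, L.zero_mem, by simp⟩
    have e2 := hp (v, -v + u) ⟨hv, hm, by simp⟩
    exact congrArg Prod.fst (e1.trans e2.symm)
  have T2 : ∀ g, ∃ v ∈ errBall n, π v = g := by
    intro g
    obtain ⟨x, rfl⟩ := QuotientAddGroup.mk'_surjective L g
    obtain ⟨p, ⟨h1, h2, h3⟩, _⟩ := hL x
    refine ⟨p.1, h1, ?_⟩
    refine (QuotientAddGroup.eq).mpr ?_
    rw [h3]; simpa using h2
  have hfin : (errBall n).Finite := by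
    refine (Set.finite_Icc (fun _ => -1 : Fin n → ℤ) (fun _ => 1)).subset ?_
    intro v hv
    refine ⟨fun i => ?_, fun i => ?_⟩ <;> rcases hv.1 i with e | e | e <;> simp [e]
  have : Finite ((Fin n → ℤ) ⧸ L) := by
    have := hfin.to_subtype
    refine Finite.of_surjective (fun v : errBall n => π v.1) ?_
    intro g
    obtain ⟨v, hv, e⟩ := T2 g
    exact ⟨⟨v, hv⟩, e⟩
  let _ := Fintype.ofFinite ((Fin n → ℤ) ⧸ L)
  have inj : Function.Injective (fun o : Option (Fin n × Bool) => π (vec o)) := fun o o' h =>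
    vec_inj (T1 _ (vec_mem o) _ (vec_mem o') h)
  let A : Finset ((Fin n → ℤ) ⧸ L) := Finset.univ.image (fun o : Option (Fin n × Bool) => π (vec o))
  have memA : ∀ x, x ∈ A ↔ ∃ o, π (vec o) = x := fun x => by simp [A]
  have cfg : Cfg n A := by
    refine ⟨?_, ?_, ?_, ?_, ?_, ?_⟩
    · exact (memA _).mpr ⟨none, by simp [vec]⟩
    · intro a ha
      obtain ⟨o, rfl⟩ := (memA _).mp ha
      obtain ⟨o', ho⟩ := vec_neg o
      exact (memA _).mpr ⟨o', by rw [ho, map_neg]⟩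
    · rw [Finset.card_image_of_injective _ inj]
      simp; ring
    · intro a ha h
      obtain ⟨o, rfl⟩ := (memA _).mp ha
      have h1 : π (vec o) = π (- vec o) := by rw [map_neg]; exact eq_neg_of_add_eq_zero_left h
      have h2 := T1 _ (vec_mem o) _ (neg_mem_ball (vec_mem o)) h1
      have h3 : vec o = 0 := by
        funext i
        have := congrFun h2 i
        simp at this ⊢
        omega
      rw [h3, map_zero]
    · intro g hg
      obtain ⟨v, hv, rfl⟩ := T2 g
      obtain ⟨o, o', hne, e⟩ := errBall_eq hv (by rintro rfl; simp at hg)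
      exact ⟨_, (memA _).mpr ⟨o, rfl⟩, _, (memA _).mpr ⟨o', rfl⟩, inj.ne hne, by rw [e, map_add]⟩
    · intro x hx y hy z hz w hw hxy hzw he h0
      obtain ⟨o1, rfl⟩ := (memA _).mp hx
      obtain ⟨o2, rfl⟩ := (memA _).mp hy
      obtain ⟨o3, rfl⟩ := (memA _).mp hz
      obtain ⟨o4, rfl⟩ := (memA _).mp hw
      have n12 : o1 ≠ o2 := fun e => hxy (by rw [e])
      have n34 : o3 ≠ o4 := fun e => hzw (by rw [e])
      rw [← map_add, ← map_add] at he
      have := T1 _ (vec_sum_mem _ _ n12) _ (vec_sum_mem _ _ n34) he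
      rcases vec_uniq o1 o2 o3 o4 n12 n34 this (fun e => h0 (by rw [← map_add, e, map_zero])) with ⟨rfl, rfl⟩ | ⟨rfl, rfl⟩
      · exact Or.inl ⟨rfl, rfl⟩
      · exact Or.inr ⟨rfl, rfl⟩
  exact cfg.main hn

abbrev GG := ZMod 3 × ZMod 3 × ZMod 3 × ZMod 3 × ZMod 3

def gcol : Fin 11 → GG :=
  ![(1,0,0,0,0), (0,1,0,0,0), (0,0,1,0,0), (0,0,0,1,0), (0,0,0,0,1),
    (1,1,1,1,1), (0,1,2,2,1), (1,0,1,2,2), (2,1,0,1,2), (2,2,1,0,1), (1,2,2,1,0)]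

def oc : Option (Fin 11 × Bool) → GG
  | none => 0
  | some (i, b) => if b then gcol i else - gcol i

def okp : Option (Fin 11 × Bool) × Option (Fin 11 × Bool) → Bool
  | (none, none) => true
  | (none, some _) => false
  | (some _, none) => true
  | (some p, some q) => decide (p.1 < q.1)

def TT : Finset (Option (Fin 11 × Bool) × Option (Fin 11 × Bool)) :=
  Finset.univ.filter (fun p => okp p = true)

set_option maxRecDepth 100000 in
lemma TT_card : TT.card = 243 := by decide +kernel

set_option maxRecDepth 100000 in
lemma TT_surj : ∀ s : GG, ∃ p ∈ TT, oc p.1 + oc p.2 = s := by decide +kernel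

def gphi : (Fin 11 → ℤ) →+ GG where
  toFun x := ∑ i, x i • gcol i
  map_zero' := by simp
  map_add' x y := by simp [add_smul, Finset.sum_add_distrib]

lemma gphi_vec (o : Option (Fin 11 × Bool)) : gphi (vec o) = oc o := by
  rcases o with _ | ⟨i, b⟩
  · exact map_zero _
  · change ∑ j, (Pi.single i (sg b) : Fin 11 → ℤ) j • gcol j = _
    rw [Finset.sum_eq_single i]
    · cases b <;> simp [sg, oc]
    · intro j _ hj; simp [hj]
    · simp

def SS : Finset (Fin 11 → ℤ) := TT.image (fun p => vec p.1 + vec p.2)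

lemma ball_SS {v : Fin 11 → ℤ} (hv : v ∈ errBall 11) : v ∈ SS := by
  have key : ∀ p, okp p = true → vec p.1 + vec p.2 ∈ SS := fun p hp =>
    Finset.mem_image.mpr ⟨p, by simp [TT, hp], rfl⟩
  have k0 : (0 : Fin 11 → ℤ) ∈ SS := by simpa [vec] using key (none, none) rfl
  by_cases h0 : v = 0
  · rw [h0]; exact k0
  obtain ⟨o, o', hne, rfl⟩ := errBall_eq hv h0
  rcases o with _ | ⟨i, b⟩
  · rcases o' with _ | q
    · exact absurd rfl hne
    · rw [add_comm]; exact key (some q, none) rfl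
  · rcases o' with _ | ⟨j, c⟩
    · exact key (_, none) rfl
    · rcases lt_trichotomy i j with h | h | h
      · exact key (some (i, b), some (j, c)) (by simp [okp, h])
      · subst h
        exfalso; apply h0
        have hbc : c = !b := by
          cases b <;> cases c <;> simp_all
        simp [vec, hbc, sg_not, Pi.single_neg]
      · rw [add_comm]; exact key (some (j, c), some (i, b)) (by simp [okp, h])

lemma SS_ball {v : Fin 11 → ℤ} (hv : v ∈ SS) : v ∈ errBall 11 := by
  obtain ⟨⟨o, o'⟩, hp, rfl⟩ := Finset.mem_image.mp hv
  have hp : okp (o, o') = true := by simpa [TT] using hp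
  by_cases h : o = o'
  · subst h
    rcases o with _ | p
    · simpa [vec] using vec_mem (n := 11) none
    · simp [okp] at hp
  · exact vec_sum_mem o o' h

lemma golay_exists : ∃ L : AddSubgroup (Fin 11 → ℤ), IsLatticeTiling 11 (errBall 11) L := by
  have surj : ∀ s : GG, ∃ v ∈ SS, gphi v = s := by
    intro s
    obtain ⟨p, hp, e⟩ := TT_surj s
    exact ⟨_, Finset.mem_image.mpr ⟨p, hp, rfl⟩, by rw [map_add, gphi_vec, gphi_vec, e]⟩
  have hcard : SS.card ≤ (Finset.univ : Finset GG).card := by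
    refine Finset.card_image_le.trans ?_
    rw [TT_card]
    simp [GG, ZMod.card]
  have inj : Set.InjOn gphi SS := by
    have him : SS.image gphi = Finset.univ := by
      ext s; simpa using surj s
    rw [← Finset.card_image_iff]
    exact le_antisymm Finset.card_image_le (by rw [him]; exact hcard)
  refine ⟨gphi.ker, fun x => ?_⟩
  obtain ⟨v, hv, e⟩ := surj (gphi x)
  refine ⟨(v, x - v), ⟨SS_ball hv, ?_, by simp⟩, ?_⟩
  · rw [AddMonoidHom.mem_ker, map_sub, e, sub_self]
  · rintro ⟨w, l⟩ ⟨hw, hl, hx⟩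
    simp only at hw hl hx
    rw [AddMonoidHom.mem_ker] at hl
    have : w = v := inj (ball_SS hw) hv (by rw [e, hx, map_add, hl, add_zero])
    subst this
    simp [hx]

theorem stmt0 (n : ℕ) (hn : 3 ≤ n) :
    (∃ L : AddSubgroup (Fin n → ℤ), IsLatticeTiling n (errBall n) L) ↔ n = 11 := by
  constructor
  · rintro ⟨L, hL⟩
    exact tiling_cfg hL hn
  · rintro rfl
    exact golay_exists
end

section
/- Let n ≥ 3 be an integer with n ≡ 1 (mod 3) and n ≠ 4. Then there is no lattice tiling of ℤⁿ by the error ball B(n,2,1,1). -/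
open Finset

section abs
variable {G : Type*} [AddCommGroup G] [Fintype G] [DecidableEq G]

theorem tri_mod (E : Finset G) (g : G) :
    ((univ : Finset (G × G)).filter (fun p => p.1 ∈ E ∧ p.2 ∈ E ∧ g - p.1 - p.2 ∈ E)).card
      ≡ (E.filter (fun a => a + a + a = g)).card [MOD 3] := by
  classical
  let X := {p : G × G // p.1 ∈ E ∧ p.2 ∈ E ∧ g - p.1 - p.2 ∈ E}
  let f : Function.End X := fun p => ⟨(p.1.2, g - p.1.1 - p.1.2), p.2.2.1, p.2.2.2, by
    have : g - p.1.2 - (g - p.1.1 - p.1.2) = p.1.1 := by abel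
    simpa [this] using p.2.1⟩
  have hf : f ^ (3 ^ 1) = 1 := by
    funext p
    apply Subtype.ext
    change ((f (f (f p))).1 : G × G) = p.1
    simp only [f]
    ext <;> simp <;> abel
  have : Fact (Nat.Prime 3) := ⟨by norm_num⟩
  have h := Equiv.Perm.card_fixedPoints_modEq (p := 3) (n := 1) hf
  have h1 : Fintype.card X = ((univ : Finset (G × G)).filter (fun p => p.1 ∈ E ∧ p.2 ∈ E ∧ g - p.1 - p.2 ∈ E)).card := by
    rw [Fintype.card_subtype]
  have h2 : Fintype.card f.fixedPoints = (E.filter (fun a => a + a + a = g)).card := by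
    rw [← Fintype.card_coe]
    refine Fintype.card_congr ⟨fun p => ⟨p.1.1.1, ?_⟩, fun a => ⟨⟨(a.1, a.1), ?_⟩, ?_⟩, ?_, ?_⟩
    · obtain ⟨⟨⟨a, b⟩, ha, hb, hc⟩, hp⟩ := p
      have h3 : b = a := congrArg (fun z : X => z.1.1) hp
      have h4 : g - a - b = b := congrArg (fun z : X => z.1.2) hp
      simp only [mem_filter]
      refine ⟨ha, ?_⟩
      subst h3
      rw [sub_sub, sub_eq_iff_eq_add] at h4
      rw [h4]; abel
    · obtain ⟨a, ha⟩ := a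
      simp only [mem_filter] at ha
      refine ⟨ha.1, ha.1, ?_⟩
      have : g - a - a = a := by rw [← ha.2]; abel
      simpa [this] using ha.1
    · obtain ⟨a, ha⟩ := a
      simp only [mem_filter] at ha
      have : g - a - a = a := by rw [← ha.2]; abel
      change f _ = _
      simp [f, this]
    · rintro ⟨⟨⟨a, b⟩, ha, hb, hc⟩, hp⟩
      have h3 : b = a := congrArg (fun z : X => z.1.1) hp
      subst h3
      rfl
    · rintro ⟨a, ha⟩
      rfl
  rw [← h1, ← h2]; exact h

theorem main_abs (E : Finset G) (n : ℕ) (hn : 2 ≤ n) (hmod : n % 3 = 1)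
    (hcard : E.card = 2 * n + 1) (h0 : (0:G) ∈ E) (hsym : ∀ a ∈ E, -a ∈ E)
    (h2 : ∀ x y : G, x + x = y + y → x = y)
    (hK : ∀ x : G, x ≠ 0 → ∃ p ∈ E, ∃ q ∈ E, p ≠ q ∧ p + q = x ∧
      ∀ a ∈ E, ∀ b ∈ E, a ≠ b → a + b = x → (a = p ∧ b = q) ∨ (a = q ∧ b = p)) : False := by
  classical
  let e : G → ℤ := fun x => if x ∈ E then 1 else 0
  have he : ∀ x, e x = if x ∈ E then 1 else 0 := fun x => rfl
  have hes : ∀ x, e (-x) = e x := by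
    intro x
    have : -x ∈ E ↔ x ∈ E := ⟨fun h => by simpa using hsym _ h, hsym x⟩
    simp [he, this]
  have hee : ∀ x, e x * e x = e x := by intro x; simp [he]
  obtain ⟨k, hk⟩ : ∃ k : ℤ, k = 2 * n + 1 := ⟨_, rfl⟩
  obtain ⟨m, hm⟩ : ∃ m : ℤ, m = 2 * n - 2 := ⟨_, rfl⟩
  have hek : ∑ x, e x = k := by simp [he, hcard, hk]
  let dbl : G ≃ G := Equiv.ofBijective (fun x => x + x)
    (Finite.injective_iff_bijective.mp (fun x y h => h2 x y h))
  have hdbl : ∀ x, dbl x = x + x := fun x => rfl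
  let e2 : G → ℤ := fun x => e (dbl.symm x)
  have he2 : ∀ y, e2 (y + y) = e y := by
    intro y; change e (dbl.symm (dbl y)) = e y; simp
  let dl : G → ℤ := fun x => if x = 0 then 1 else 0
  have hdl2 : ∀ x, dl (x + x) = dl x := by
    intro x
    have : x + x = 0 ↔ x = 0 := ⟨fun h => h2 x 0 (by simpa using h), fun h => by simp [h]⟩
    simp [dl, this]
  have he20 : e2 0 = 1 := by
    have := he2 0; rw [add_zero] at this; rw [this]; simp [he, h0]
  have hN : ∀ x, ∑ a, e a * e (x - a) = 2 + e2 x + m * dl x := by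
    intro x
    by_cases hx : x = 0
    · subst hx
      simp only [zero_sub, hes, hee, hek, he20, dl]
      simp [hk, hm]; ring
    · obtain ⟨p, hp, q, hq, hpq, hs, hu⟩ := hK x hx
      obtain ⟨y, rfl⟩ : ∃ y, x = y + y := ⟨dbl.symm x, by rw [← hdbl]; simp⟩
      rw [he2]
      have hyp : y ≠ p := by
        rintro rfl; exact hpq (add_left_cancel hs).symm
      have hyq : y ≠ q := by
        rintro rfl; exact hpq (add_right_cancel hs)
      have key : ∀ a, e a * e (y + y - a) = (if a = p then 1 else 0) + (if a = q then 1 else 0) + (if a = y then e y else 0) := by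
        intro a
        by_cases h1 : a = p
        · subst h1
          have : y + y - a = q := by rw [← hs]; abel
          simp [this, he, hp, hq, hpq, Ne.symm hyp]
        by_cases h3 : a = q
        · subst h3
          have : y + y - a = p := by rw [← hs]; abel
          simp [this, he, hp, hq, Ne.symm hpq, Ne.symm hyq]
        by_cases h4 : a = y
        · subst h4
          simp [h1, h3, hee]
        · simp only [h1, h3, h4, if_false, he]
          by_cases h5 : a ∈ E
          · by_cases h6 : y + y - a ∈ E
            · exfalso
              have h7 : a ≠ y + y - a := by
                intro h
                apply h4; apply h2
                rw [eq_sub_iff_add_eq] at h; exact h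
              rcases hu a h5 _ h6 h7 (by abel) with h | h
              · exact h1 h.1
              · exact h3 h.1
            · simp [h6]
          · simp [h5]
      rw [Finset.sum_congr rfl (fun a _ => key a)]
      simp [Finset.sum_add_distrib, dl, hx]
  let c : G → ℤ := fun g => ∑ b, e b * e (g - (b + b))
  -- first moment
  have shift : ∀ (f : G → ℤ) (t : G), ∑ g, f (g - t) = ∑ g, f g := fun f t =>
    Equiv.sum_comp (Equiv.subRight t) f
  have hdls : ∀ f : G → ℤ, ∑ x, f x * dl x = f 0 := by
    intro f; simp [dl]
  have hE0 : e 0 = 1 := by simp [he, h0]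
  have hS1 : ∑ g, c g = k * k := by
    simp only [c]
    rw [Finset.sum_comm]
    simp_rw [← Finset.mul_sum, shift, hek, ← Finset.sum_mul, hek]
  have he2k : ∑ x, e2 x = k := by
    rw [← hek]; exact Equiv.sum_comp dbl.symm e
  have hV : k * k = 2 * (Fintype.card G : ℤ) + k + m := by
    have : ∑ x, ∑ a, e a * e (x - a) = k * k := by
      rw [Finset.sum_comm]
      simp_rw [← Finset.mul_sum, shift, hek, ← Finset.sum_mul, hek]
    rw [← this, Finset.sum_congr rfl (fun x _ => hN x)]
    rw [Finset.sum_add_distrib, Finset.sum_add_distrib, he2k, hdls (fun _ => m)]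
    simp; ring
  have hSE : ∑ g, e g * c g = 3 * k + m := by
    simp only [c, Finset.mul_sum]
    rw [Finset.sum_comm]
    have : ∀ b, ∑ g, e g * (e b * e (g - (b + b))) = 2 * e b + e b + m * e b * dl b := by
      intro b
      have h1 : ∀ g, e g * (e b * e (g - (b + b))) = e b * (e g * e (b + b - g)) := by
        intro g
        rw [← hes (g - (b+b)), neg_sub]; ring
      simp_rw [h1, ← Finset.mul_sum]
      rw [hN, he2, hdl2]
      linear_combination hee b
    simp_rw [this]
    rw [Finset.sum_add_distrib, Finset.sum_add_distrib, ← Finset.mul_sum, hek, hdls (fun b => m * e b), hE0]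
    ring
  have hc0 : c 0 = ∑ y, e2 y * e y := by
    rw [← Equiv.sum_comp dbl]
    simp only [c, hdbl, he2, zero_sub, hes]
  have hS2 : ∑ g, c g * c g = 4 * (Fintype.card G : ℤ) + 4 * k + 6 * m + m * m + c 0 := by
    have h1 : ∑ g, c g * c g = ∑ b, ∑ b', e b * e b' * ∑ g, e (g - (b + b)) * e (g - (b' + b')) := by
      simp only [c, Finset.sum_mul_sum]
      rw [Finset.sum_comm]
      refine Finset.sum_congr rfl fun b _ => ?_
      rw [Finset.sum_comm]
      refine Finset.sum_congr rfl fun b' _ => ?_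
      rw [Finset.mul_sum]
      refine Finset.sum_congr rfl fun g _ => ?_
      ring
    have h3 : ∀ b b' : G, ∑ g, e (g - (b + b)) * e (g - (b' + b')) = 2 + e (b' - b) + m * dl (b' - b) := by
      intro b b'
      rw [← he2, ← hdl2, ← hN, ← shift (fun a => e a * e (b' - b + (b' - b) - a)) (b + b)]
      refine Finset.sum_congr rfl fun g _ => ?_
      rw [← hes (g - (b' + b'))]
      congr 2; abel
    have h5 : ∑ g, c g * c g = ∑ y, (2 + e2 y + m * dl y) * (2 + e y + m * dl y) := by
      rw [h1]
      simp_rw [h3]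
      have h6 : ∀ b, ∑ b', e b * e b' * (2 + e (b' - b) + m * dl (b' - b)) =
          ∑ y, e b * e (y + b) * (2 + e y + m * dl y) := by
        intro b
        rw [← shift (fun y => e b * e (y + b) * (2 + e y + m * dl y)) b]
        refine Finset.sum_congr rfl fun g _ => ?_
        simp
      simp_rw [h6]
      rw [Finset.sum_comm]
      refine Finset.sum_congr rfl fun y _ => ?_
      rw [← Finset.sum_mul, ← hN]
      congr 1
      rw [← Equiv.sum_comp (Equiv.neg G)]
      refine Finset.sum_congr rfl fun g _ => ?_
      simp only [Equiv.neg_apply, hes]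
      congr 2; abel
    rw [h5, hc0]
    have h7 : ∀ y, (2 + e2 y + m * dl y) * (2 + e y + m * dl y) =
        4 + 2 * e y + 2 * e2 y + e2 y * e y + (4 * m + m * e2 y + m * e y + m * m * dl y) * dl y := by
      intro y; ring
    simp_rw [h7]
    simp only [Finset.sum_add_distrib, ← Finset.mul_sum, hek, he2k]
    rw [hdls (fun y => 4 * m + m * e2 y + m * e y + m * m * dl y), he20, hE0]
    simp [dl]; ring
  -- mod 3
  let t : G → ℕ := fun g => (E.filter (fun a => a + a + a = g)).card
  have hT : ∀ g, ∑ a, ∑ b, e a * (e b * e (g - a - b)) = 2 * k + c g + m * e g := by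
    intro g
    simp_rw [← Finset.mul_sum, hN]
    have h8 : ∀ a, e a * (2 + e2 (g - a) + m * dl (g - a)) = 2 * e a + e a * e2 (g - a) + m * e a * dl (g - a) := by
      intro a; ring
    simp_rw [h8, Finset.sum_add_distrib, ← Finset.mul_sum, hek]
    congr 1
    · congr 1
      rw [← Equiv.sum_comp (Equiv.subLeft g)]
      simp only [Equiv.subLeft_apply, sub_sub_cancel]
      rw [← Equiv.sum_comp dbl]
      simp only [hdbl, he2, c]
      refine Finset.sum_congr rfl fun b _ => ?_
      ring
    · have : ∀ a, dl (g - a) = if g = a then 1 else 0 := by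
        intro a; simp [dl, sub_eq_zero]
      simp [this]
  have hct : ∀ g, (3 : ℤ) ∣ c g - t g := by
    intro g
    have h9 := (Nat.modEq_iff_dvd.mp (tri_mod E g))
    have h10 : ((((univ : Finset (G × G)).filter (fun p => p.1 ∈ E ∧ p.2 ∈ E ∧ g - p.1 - p.2 ∈ E)).card : ℕ) : ℤ)
        = 2 * k + c g + m * e g := by
      rw [← hT, Finset.card_filter]
      push_cast
      rw [Fintype.sum_prod_type]
      refine Finset.sum_congr rfl fun a _ => Finset.sum_congr rfl fun b _ => ?_
      simp only [he]
      by_cases h1 : a ∈ E <;> by_cases h2 : b ∈ E <;> by_cases h3 : g - a - b ∈ E <;> simp [h1, h2, h3]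
    rw [h10] at h9
    have hk3 : (3:ℤ) ∣ k := by omega
    have hm3 : (3:ℤ) ∣ m := by omega
    have := dvd_mul_of_dvd_left hm3 (e g)
    change ((3:ℕ):ℤ) ∣ (t g : ℤ) - _ at h9
    push_cast at h9
    omega
  -- closure under tripling
  have htrip : ∀ d ∈ E, d + d + d ∈ E := by
    intro d hd
    by_contra hnd
    have hd0 : d ≠ 0 := by rintro rfl; simp [h0] at hnd
    have hcd : c d = 2 + t d := by
      have hc1 : c d = ((E.filter (fun b => d - (b + b) ∈ E)).card : ℤ) := by
        simp only [c, he, Finset.card_filter]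
        push_cast
        rw [← Finset.sum_subset (Finset.subset_univ E)]
        · refine Finset.sum_congr rfl fun b hb => ?_
          simp [hb]
        · intro b _ hb; simp [hb]
      have hset : E.filter (fun b => d - (b + b) ∈ E) = insert 0 (insert d (E.filter (fun a => a + a + a = d))) := by
        ext b
        simp only [mem_filter, mem_insert]
        constructor
        · rintro ⟨hb, ha⟩
          by_cases hb0 : b = 0
          · exact Or.inl hb0
          by_cases hbd : b = d
          · exact Or.inr (Or.inl hbd)
          right; right
          refine ⟨hb, ?_⟩
          by_contra h3
          have hx : d + -b ≠ 0 := by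
            rw [← sub_eq_add_neg, sub_ne_zero]; exact Ne.symm hbd
          have hdb : d ≠ -b := by
            rintro rfl
            apply hnd
            have h11 := hsym _ (hsym _ ha)
            convert h11 using 1; abel
          have hab : d - (b + b) ≠ b := by
            intro h; apply h3
            rw [sub_eq_iff_eq_add] at h; rw [h]; abel
          obtain ⟨p, hp, q, hq, hpq, hs, hu⟩ := hK _ hx
          have u1 := hu d hd (-b) (hsym b hb) hdb rfl
          have u2 := hu _ ha b hb hab (by abel)
          have : d = d - (b + b) ∨ d = b := by
            rcases u1 with ⟨r1, r2⟩ | ⟨r1, r2⟩ <;> rcases u2 with ⟨s1, s2⟩ | ⟨s1, s2⟩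
            · left; rw [s1, ← r1]
            · right; rw [s2, ← r1]
            · right; rw [s2, ← r1]
            · left; rw [s1, ← r1]
          rcases this with h | h
          · apply hb0; apply h2
            rw [eq_sub_iff_add_eq] at h
            simpa using h
          · exact hbd h.symm
        · rintro (rfl | rfl | ⟨h1, h3⟩)
          · exact ⟨h0, by simpa using hd⟩
          · refine ⟨hd, ?_⟩
            have : b - (b + b) = -b := by abel
            rw [this]; exact hsym b hd
          · refine ⟨h1, ?_⟩
            have : d - (b + b) = b := by rw [← h3]; abel
            rw [this]; exact h1
      rw [hc1, hset, Finset.card_insert_of_notMem, Finset.card_insert_of_notMem]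
      · simp only [t]; push_cast; ring
      · simp only [mem_filter, not_and]
        intro _ h
        apply hd0; apply h2
        have : d + d + d = 0 + d := by rw [h]; simp
        simpa using add_right_cancel this
      · simp only [mem_insert, mem_filter, not_or, not_and]
        exact ⟨Ne.symm hd0, fun _ h => hd0 (by simpa using h.symm)⟩
    have := hct d
    rw [hcd] at this
    omega
  have hout : ∀ g, g ∉ E → (3:ℤ) ∣ c g := by
    intro g hg
    have ht0 : t g = 0 := by
      simp only [t, Finset.card_eq_zero, Finset.filter_eq_empty_iff]
      intro a ha h
      exact hg (h ▸ htrip a ha)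
    simpa [ht0] using hct g
  have hineq : ∀ g, (4 * (c g - 3)) * e g + (c 0 * (c 0 - 3) - 4 * (c 0 - 3)) * dl g ≤ c g * c g - 3 * c g := by
    intro g
    by_cases hg0 : g = 0
    · subst hg0
      simp [dl, hE0]; linarith
    · simp only [dl, hg0, if_false, mul_zero, add_zero]
      by_cases hg : g ∈ E
      · simp only [he, hg, if_true, mul_one]
        have : 0 ≤ (c g - 3) * (c g - 4) := by
          rcases le_or_gt (c g) 3 with h | h
          · nlinarith
          · have : 4 ≤ c g := h
            nlinarith
        linarith
      · simp only [he, hg, if_false, mul_zero]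
        obtain ⟨j, hj⟩ := hout g hg
        rw [hj]
        have : 0 ≤ j * (j - 1) := by
          rcases le_or_gt j 0 with h | h
          · nlinarith
          · have : 1 ≤ j := h
            nlinarith
        nlinarith
  have hfin := Finset.sum_le_sum (fun g (_ : g ∈ (univ : Finset G)) => hineq g)
  rw [Finset.sum_add_distrib, hdls (fun _ => c 0 * (c 0 - 3) - 4 * (c 0 - 3)), Finset.sum_sub_distrib,
    ← Finset.mul_sum, hS1, hS2] at hfin
  have h12 : ∑ g, (4 * (c g - 3)) * e g = 4 * (3 * k + m) - 12 * k := by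
    have : ∀ g, (4 * (c g - 3)) * e g = 4 * (e g * c g) - 12 * e g := by intro g; ring
    simp_rw [this]
    rw [Finset.sum_sub_distrib, ← Finset.mul_sum, ← Finset.mul_sum, hSE, hek]
  rw [h12] at hfin
  have hn' : (2:ℤ) ≤ n := by exact_mod_cast hn
  have hkm : k = m + 3 := by rw [hk, hm]; ring
  have hm2 : 2 ≤ m := by linarith
  subst hkm
  nlinarith [sq_nonneg (c 0 - 4)]
end abs

theorem wt_one {n : ℕ} (w : Option (Fin n × Bool) → (Fin n → ℤ))
    (hw : w = fun o => o.elim 0 (fun p => Pi.single p.1 (if p.2 then 1 else -1))) (o : Option (Fin n × Bool))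
    (i : Fin n) (hi : w o i ≠ 0) : (w o i = 1 ∨ w o i = -1) ∧ w o = Pi.single i (w o i) := by
  subst hw
  rcases o with _ | ⟨j, b⟩
  · simp at hi
  · simp only [Option.elim] at hi ⊢
    by_cases hij : i = j
    · subst hij
      cases b <;> simp
    · simp [Pi.single_apply, hij] at hi

theorem stmt11 (n : ℕ) (hn : 3 ≤ n) (hmod : n % 3 = 1) (h4 : n ≠ 4) :
    ¬ ∃ L : AddSubgroup (Fin n → ℤ), IsLatticeTiling n (errBall n) L := by
  classical
  rintro ⟨L, hL⟩
  let φ : (Fin n → ℤ) →+ ((Fin n → ℤ) ⧸ L) := QuotientAddGroup.mk' L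
  have hφ : ∀ x, φ x = 0 ↔ x ∈ L := fun x => QuotientAddGroup.eq_zero_iff x
  have hsur : ∀ g, ∃ v ∈ errBall n, φ v = g := by
    intro g
    obtain ⟨x, rfl⟩ := QuotientAddGroup.mk'_surjective L g
    obtain ⟨⟨v, l⟩, ⟨hv, hl, hx⟩, -⟩ := hL x
    refine ⟨v, hv, ?_⟩
    simp only at hx hl
    have h1 : φ l = 0 := (hφ l).2 hl
    change φ v = φ x
    rw [hx, map_add, h1, add_zero]
  have hinj : ∀ u ∈ errBall n, ∀ v ∈ errBall n, φ u = φ v → u = v := by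
    intro u hu v hv h
    have h1 : u - v ∈ L := by rw [← hφ, map_sub, h, sub_self]
    obtain ⟨p, -, hp⟩ := hL u
    have e1 := hp (u, 0) ⟨hu, L.zero_mem, by simp⟩
    have e2 := hp (v, u - v) ⟨hv, h1, by simp⟩
    have := e1.trans e2.symm
    exact congrArg Prod.fst this
  have hfinB : (errBall n).Finite := by
    apply (Set.Finite.pi' (fun _ : Fin n => (Set.finite_Icc (-1:ℤ) 1))).subset
    intro a ha i
    rcases ha.1 i with h | h | h <;> simp [h]
  have : Finite ((Fin n → ℤ) ⧸ L) := by
    have := hfinB.to_subtype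
    exact Finite.of_surjective (fun v : errBall n => φ v.1) (fun g => by
      obtain ⟨v, hv, h⟩ := hsur g; exact ⟨⟨v, hv⟩, h⟩)
  have := Fintype.ofFinite ((Fin n → ℤ) ⧸ L)
  have hneg : ∀ v ∈ errBall n, -v ∈ errBall n := by
    intro v hv
    refine ⟨fun i => ?_, ?_⟩
    · have := hv.1 i
      simp only [Pi.neg_apply]; omega
    · simpa using hv.2
  have hzero : (0 : Fin n → ℤ) ∈ errBall n := by
    constructor <;> simp
  obtain ⟨w, hw⟩ : ∃ w : Option (Fin n × Bool) → (Fin n → ℤ),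
    w = fun o => o.elim 0 (fun p => Pi.single p.1 (if p.2 then 1 else -1)) := ⟨_, rfl⟩
  have hw1 := wt_one w hw
  have hw0 : w none = 0 := by rw [hw]; rfl
  have hwj : ∀ j b, w (some (j, b)) = Pi.single j (if b then 1 else -1) := by
    intro j b; rw [hw]; rfl
  have hwinj : Function.Injective w := by
    intro o o' h
    rcases o with _ | ⟨j, b⟩ <;> rcases o' with _ | ⟨j', b'⟩
    · rfl
    · have := congrFun h j'
      rw [hw0, hwj] at this
      cases b' <;> simp at this
    · have := congrFun h j
      rw [hw0, hwj] at this
      cases b <;> simp at this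
    · have := congrFun h j
      rw [hwj, hwj] at this
      by_cases hj : j = j'
      · subst hj
        cases b <;> cases b' <;> simp at this ⊢
      · cases b <;> simp [Pi.single_apply, hj] at this
  -- the sum of two distinct short vectors is in the ball
  have hsumB : ∀ o o', w o ≠ w o' → w o + w o' ∈ errBall n := by
    intro o o' hne
    constructor
    · intro i
      simp only [Pi.add_apply]
      by_cases h1 : w o i = 0
      · by_cases h2 : w o' i = 0
        · simp [h1, h2]
        · have := (hw1 o' i h2).1; omega
      · by_cases h2 : w o' i = 0
        · have := (hw1 o i h1).1; omega
        · obtain ⟨a1, a2⟩ := hw1 o i h1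
          obtain ⟨b1, b2⟩ := hw1 o' i h2
          have : w o i ≠ w o' i := by
            intro h; apply hne; rw [a2, b2, h]
          omega
    · have hc : ∀ o, ((univ : Finset (Fin n)).filter (fun i => w o i ≠ 0)).card ≤ 1 := by
        intro o
        rw [Finset.card_le_one]
        intro a ha b hb
        simp only [mem_filter, mem_univ, true_and] at ha hb
        have h1 := (hw1 o a ha).2
        rw [h1] at hb
        by_contra hab
        simp [Pi.single_apply, Ne.symm hab] at hb
      calc _ ≤ (((univ : Finset (Fin n)).filter (fun i => w o i ≠ 0)) ∪ ((univ : Finset (Fin n)).filter (fun i => w o' i ≠ 0))).card := by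
            apply Finset.card_le_card
            intro i
            simp only [mem_filter, mem_univ, true_and, mem_union, Pi.add_apply]
            intro h
            by_contra hh
            push Not at hh
            simp [hh.1, hh.2] at h
        _ ≤ _ := (Finset.card_union_le _ _).trans (by have := hc o; have := hc o'; omega)
  have hwB : ∀ o, w o ∈ errBall n := by
    intro o
    by_cases h : w o = 0
    · rw [h]; exact hzero
    · have := hsumB o none (by rw [hw0]; exact h)
      simpa [hw0] using this
  -- a vector of this shape is short
  have hrec : ∀ (i : Fin n) (z : ℤ), z = 1 ∨ z = -1 → ∃ o, w o = Pi.single i z := by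
    intro i z hz
    rcases hz with rfl | rfl
    · exact ⟨some (i, true), by rw [hwj]; rfl⟩
    · exact ⟨some (i, false), by rw [hwj]; rfl⟩
  have hdec : ∀ v ∈ errBall n, v ≠ 0 → ∃ o o', w o ≠ w o' ∧ w o + w o' = v := by
    intro v hv hv0
    obtain ⟨i, hi⟩ : ∃ i, v i ≠ 0 := by
      by_contra h; push Not at h; exact hv0 (funext h)
    obtain ⟨o, ho⟩ := hrec i (v i) (by have := hv.1 i; omega)
    have : ∃ o', w o' = v - Pi.single i (v i) := by
      by_cases hq : v - Pi.single i (v i) = 0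
      · exact ⟨none, by rw [hq, hw0]⟩
      · obtain ⟨j, hj⟩ : ∃ j : Fin n, (v - Pi.single i (v i) : Fin n → ℤ) j ≠ 0 := by
          by_contra h; push Not at h; exact hq (funext h)
        have hji : j ≠ i := by rintro rfl; simp at hj
        have hvj : v j ≠ 0 := by simpa [Pi.single_apply, hji] using hj
        obtain ⟨o', ho'⟩ := hrec j (v j) (by have := hv.1 j; omega)
        refine ⟨o', ?_⟩
        rw [ho']
        have hc := hv.2
        have hsub : ({i, j} : Finset (Fin n)) ⊆ univ.filter (fun i => v i ≠ 0) := by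
          intro x; simp only [mem_insert, mem_singleton, mem_filter, mem_univ, true_and]
          rintro (rfl | rfl) <;> assumption
        have heq := Finset.eq_of_subset_of_card_le hsub (by rw [Finset.card_pair (Ne.symm hji)]; exact hc)
        funext x
        by_cases hxi : x = i
        · subst hxi; simp [Pi.single_apply, Ne.symm hji]
        by_cases hxj : x = j
        · subst hxj; simp [Pi.single_apply, hxi]
        have : x ∉ univ.filter (fun i => v i ≠ 0) := by
          rw [← heq]; simp [hxi, hxj]
        simp only [mem_filter, mem_univ, true_and, not_not] at this
        simp [Pi.single_apply, hxi, hxj, this]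
    obtain ⟨o', ho'⟩ := this
    refine ⟨o, o', ?_, ?_⟩
    · rw [ho, ho']
      intro h
      have := congrFun h i
      simp at this
      exact hi this
    · rw [ho, ho']; abel
  have hcoord : ∀ a b p q, w a ≠ w b → w a + w b ≠ 0 → w a + w b = w p + w q → w a ≠ 0 →
      w a = w p ∨ w a = w q := by
    intro a b p q hab hs heq ha
    obtain ⟨i, hi⟩ : ∃ i, w a i ≠ 0 := by
      by_contra h; push Not at h; exact ha (funext h)
    obtain ⟨a1, a2⟩ := hw1 a i hi
    have hb : w b i = 0 := by
      by_contra hb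
      obtain ⟨b1, b2⟩ := hw1 b i hb
      have n1 : w a i ≠ w b i := by
        intro h; apply hab; rw [a2, b2, h]
      have n2 : w a i + w b i = 0 := by omega
      apply hs
      rw [a2, b2, ← Pi.single_add, n2, Pi.single_zero]
    have hc := congrFun heq i
    simp only [Pi.add_apply, hb, add_zero] at hc
    have hp : w p i = 0 ∨ w p i = 1 ∨ w p i = -1 := by
      by_cases h : w p i = 0
      · exact Or.inl h
      · exact Or.inr (hw1 p i h).1
    have hq : w q i = 0 ∨ w q i = 1 ∨ w q i = -1 := by
      by_cases h : w q i = 0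
      · exact Or.inl h
      · exact Or.inr (hw1 q i h).1
    have : w p i = w a i ∨ w q i = w a i := by omega
    rcases this with h | h
    · left; rw [a2, (hw1 p i (by rw [h]; exact hi)).2, h]
    · right; rw [a2, (hw1 q i (by rw [h]; exact hi)).2, h]
  have huniq : ∀ a b p q, w a ≠ w b → w a + w b ≠ 0 → w a + w b = w p + w q →
      (w a = w p ∧ w b = w q) ∨ (w a = w q ∧ w b = w p) := by
    intro a b p q hab hs heq
    by_cases ha : w a = 0
    · have hb : w b ≠ 0 := fun h => hab (by rw [ha, h])
      rcases hcoord b a p q (Ne.symm hab) (by rwa [add_comm]) (by rwa [add_comm]) hb with h | h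
      · right; refine ⟨?_, h⟩
        rw [h, add_comm] at heq; exact add_left_cancel heq
      · left; refine ⟨?_, h⟩
        rw [h] at heq; exact add_right_cancel heq
    · rcases hcoord a b p q hab hs heq ha with h | h
      · left; refine ⟨h, ?_⟩
        rw [h] at heq; exact add_left_cancel heq
      · right; refine ⟨h, ?_⟩
        rw [h, add_comm] at heq; exact add_right_cancel heq
  refine main_abs (univ.image (fun o => φ (w o))) n (by omega) hmod ?_ ?_ ?_ ?_ ?_
  · rw [Finset.card_image_of_injective]
    · simp; ring
    · intro o o' h
      exact hwinj (hinj _ (hwB o) _ (hwB o') h)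
  · simp only [mem_image, mem_univ, true_and]
    exact ⟨none, by rw [hw0, map_zero]⟩
  · simp only [mem_image, mem_univ, true_and]
    rintro _ ⟨o, rfl⟩
    rcases o with _ | ⟨j, b⟩
    · exact ⟨none, by simp [hw0]⟩
    · refine ⟨some (j, !b), ?_⟩
      rw [← map_neg, hwj, hwj, ← Pi.single_neg]
      cases b <;> simp
  · intro x y hxy
    obtain ⟨v, hv, hvx⟩ := hsur (x - y)
    have h1 : φ v = φ (-v) := by
      rw [map_neg, hvx, neg_sub, sub_eq_sub_iff_add_eq_add, hxy]
    have h2 := hinj v hv _ (hneg v hv) h1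
    have h3 : v = 0 := by
      funext i
      have := congrFun h2 i
      simp only [Pi.neg_apply, Pi.zero_apply] at this ⊢
      omega
    rw [h3, map_zero] at hvx
    exact (sub_eq_zero.mp hvx.symm)
  · intro x hx
    obtain ⟨v, hv, rfl⟩ := hsur x
    have hv0 : v ≠ 0 := by rintro rfl; simp at hx
    obtain ⟨p, q, hpq, hs⟩ := hdec v hv hv0
    refine ⟨φ (w p), by simp, φ (w q), by simp, ?_, ?_, ?_⟩
    · intro h; exact hpq (hinj _ (hwB p) _ (hwB q) h)
    · rw [← map_add, hs]
    · simp only [mem_image, mem_univ, true_and]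
      rintro _ ⟨a, rfl⟩ _ ⟨b, rfl⟩ hab hsum
      have hab' : w a ≠ w b := fun h => hab (by rw [h])
      rw [← map_add] at hsum
      have h5 := hinj _ (hsumB a b hab') v hv hsum
      rcases huniq a b p q hab' (by rw [h5]; exact hv0) (by rw [h5, hs]) with ⟨r1, r2⟩ | ⟨r1, r2⟩
      · left; rw [r1, r2]; exact ⟨rfl, rfl⟩
      · right; rw [r1, r2]; exact ⟨rfl, rfl⟩
end
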